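/- Let d ∈ ℕ, 2 ≤ q ≤ p' ≤ ∞ with q not an even integer. Then there exists a positive finite Borel measure μ on ℝ^d such that, with u(t,·) = H_t ∗ μ, the quantity Q_{p,q}(t) := t^{(d/2)(1/q − 1/p')} ‖(u(t,·)^{1/p})^∧‖_{L^q(ℝ^d)} is strictly decreasing for all sufficiently small t > 0. -/

import Mathlib

open MeasureTheory Real Filter
open scoped FourierTransform ENNReal Topology

/-- The heat kernel `H_t(x) = t^{-d/2} e^{-π|x|²/t}` on `ℝ^d`. -/
noncomputable def heatKernel (d : ℕ) (t : ℝ) (x : EuclideanSpace ℝ (Fin d)) : ℝ :=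
  t ^ (-(d : ℝ) / 2) * Real.exp (-π * ‖x‖ ^ 2 / t)

/-- The solution `u(t,·) = H_t ∗ μ` of the heat equation with initial datum `μ`. -/
noncomputable def heatEvolution (d : ℕ) (μ : Measure (EuclideanSpace ℝ (Fin d)))
    (t : ℝ) (x : EuclideanSpace ℝ (Fin d)) : ℝ :=
  ∫ y, heatKernel d t (x - y) ∂μ

/-- `Q_{p,q}(t) = t^{(d/2)(1/q - 1/p')} ‖(u(t,·)^{1/p})^∧‖_{L^q(ℝ^d)}`, where `1/p' = 1 - 1/p`. -/
noncomputable def Q (d : ℕ) (μ : Measure (EuclideanSpace ℝ (Fin d))) (p q t : ℝ) : ℝ :=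
  t ^ ((d : ℝ) / 2 * (1 / q - (1 - 1 / p))) *
    (eLpNorm (𝓕 fun x => ((heatEvolution d μ t x ^ (1 / p) : ℝ) : ℂ))
      (ENNReal.ofReal q) volume).toReal

lemma hA1 {α a b : ℝ} (hα : 0 ≤ α) (hb : 0 ≤ b) (hab : b ≤ a) :
    b * (a ^ α - b ^ α) ≤ (α + 1) * a ^ α * (a - b) := by
  rcases eq_or_lt_of_le (hb.trans hab) with h0 | ha
  · have : b = 0 := by linarith
    simp [this, ← h0]
  have h1 : 1 + (α + 1) * (b / a - 1) ≤ (1 + (b / a - 1)) ^ (α + 1) := by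
    apply one_add_mul_self_le_rpow_one_add
    · have : 0 ≤ b / a := by positivity
      linarith
    · linarith
  have h2 : (1 + (b / a - 1)) ^ (α + 1) = b ^ (α + 1) / a ^ (α + 1) := by
    rw [← Real.div_rpow hb ha.le]; ring_nf
  have ha1 : a ^ (α + 1) = a ^ α * a := by rw [Real.rpow_add_one ha.ne']
  have hb1 : b ^ (α + 1) = b ^ α * b := by
    rcases eq_or_lt_of_le hb with h | h
    · rw [← h]; rw [Real.zero_rpow (by linarith)]; simp
    · rw [Real.rpow_add_one h.ne']
  have hap : 0 < a ^ α := Real.rpow_pos_of_pos ha _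
  rw [h2, le_div_iff₀ (by positivity), ha1, hb1] at h1
  have h3 : (1 + (α + 1) * (b / a - 1)) * (a ^ α * a) = a ^ α * a + (α + 1) * a ^ α * (b - a) := by
    field_simp
  rw [h3] at h1
  nlinarith

lemma hA2 {q R : ℝ} (hq : 2 ≤ q) {z w : ℂ} (hz : ‖z‖ ≤ R) (hw : ‖w‖ ≤ R) :
    ‖(‖z‖ ^ (q - 2)) • z - (‖w‖ ^ (q - 2)) • w‖ ≤ q * R ^ (q - 2) * ‖z - w‖ := by
  wlog h : ‖w‖ ≤ ‖z‖ generalizing z w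
  · have := this hw hz (le_of_not_ge h)
    rwa [norm_sub_rev, norm_sub_rev w z] at this
  have e : (‖z‖ ^ (q - 2)) • z - (‖w‖ ^ (q - 2)) • w =
      (‖z‖ ^ (q - 2)) • (z - w) + (‖z‖ ^ (q - 2) - ‖w‖ ^ (q - 2)) • w := by
    module
  have hR : ‖z‖ ^ (q - 2) ≤ R ^ (q - 2) := Real.rpow_le_rpow (norm_nonneg _) hz (by linarith)
  have hwz : ‖w‖ ^ (q - 2) ≤ ‖z‖ ^ (q - 2) := Real.rpow_le_rpow (norm_nonneg _) h (by linarith)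
  have h1 := hA1 (α := q - 2) (by linarith) (norm_nonneg w) h
  have h2 := norm_sub_norm_le z w
  have hp : 0 ≤ ‖z‖ ^ (q - 2) := by positivity
  rw [e]
  calc _ ≤ ‖(‖z‖ ^ (q - 2)) • (z - w)‖ + ‖(‖z‖ ^ (q - 2) - ‖w‖ ^ (q - 2)) • w‖ := norm_add_le _ _
    _ = ‖z‖ ^ (q - 2) * ‖z - w‖ + ‖w‖ * (‖z‖ ^ (q - 2) - ‖w‖ ^ (q - 2)) := by
      rw [norm_smul, norm_smul, Real.norm_of_nonneg hp, Real.norm_of_nonneg (by linarith)]; ring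
    _ ≤ ‖z‖ ^ (q - 2) * ‖z - w‖ + (q - 2 + 1) * ‖z‖ ^ (q - 2) * ‖z - w‖ := by
      have : (q - 2 + 1) * ‖z‖ ^ (q - 2) * (‖z‖ - ‖w‖) ≤ (q - 2 + 1) * ‖z‖ ^ (q - 2) * ‖z - w‖ :=
        mul_le_mul_of_nonneg_left h2 (by apply mul_nonneg; linarith; exact hp)
      linarith
    _ = q * ‖z‖ ^ (q - 2) * ‖z - w‖ := by ring
    _ ≤ _ := by gcongr

/-- derivative of `‖·‖^q` as a functional -/
noncomputable def dphi (q : ℝ) (z w : ℂ) : ℝ := q * inner ℝ ((‖z‖ ^ (q - 2)) • z) w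

lemma dphi_le {q R : ℝ} (hq : 2 ≤ q) {z w : ℂ} (hz : ‖z‖ ≤ R) :
    |dphi q z w| ≤ q * R ^ (q - 2) * ‖z‖ * ‖w‖ := by
  unfold dphi
  rw [abs_mul, abs_of_nonneg (by linarith : (0:ℝ) ≤ q)]
  have h := abs_real_inner_le_norm ((‖z‖ ^ (q - 2)) • z) w
  have hR : ‖z‖ ^ (q - 2) ≤ R ^ (q - 2) := Real.rpow_le_rpow (norm_nonneg _) hz (by linarith)
  rw [norm_smul, Real.norm_of_nonneg (by positivity)] at h
  calc _ ≤ q * (‖z‖ ^ (q - 2) * ‖z‖ * ‖w‖) := by gcongr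
    _ ≤ q * (R ^ (q - 2) * ‖z‖ * ‖w‖) := by gcongr
    _ = _ := by ring

lemma dphi_sub_le {q R : ℝ} (hq : 2 ≤ q) {z z' w : ℂ} (hz : ‖z‖ ≤ R) (hz' : ‖z'‖ ≤ R) :
    |dphi q z w - dphi q z' w| ≤ q ^ 2 * R ^ (q - 2) * ‖z - z'‖ * ‖w‖ := by
  unfold dphi
  rw [← mul_sub, ← inner_sub_left, abs_mul, abs_of_nonneg (by linarith : (0:ℝ) ≤ q)]
  have h := abs_real_inner_le_norm ((‖z‖ ^ (q - 2)) • z - (‖z'‖ ^ (q - 2)) • z') w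
  have h2 := hA2 hq hz hz'
  calc _ ≤ q * (‖(‖z‖ ^ (q - 2)) • z - (‖z'‖ ^ (q - 2)) • z'‖ * ‖w‖) := by gcongr
    _ ≤ q * ((q * R ^ (q - 2) * ‖z - z'‖) * ‖w‖) := by gcongr
    _ = _ := by ring

lemma dphi_sub_right {q : ℝ} {z w w' : ℂ} : dphi q z (w - w') = dphi q z w - dphi q z w' := by
  unfold dphi; rw [inner_sub_right]; ring

lemma hasDerivAt_phi {q : ℝ} (hq : 2 ≤ q) (a h : ℂ) (s : ℝ) :
    HasDerivAt (fun s : ℝ => ‖a + s • h‖ ^ q) (dphi q (a + s • h) h) s := by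
  have h1 := hasFDerivAt_norm_rpow (a + s • h) (show 1 < q by linarith)
  have h2 : HasDerivAt (fun s : ℝ => a + s • h) h s := by
    simpa using ((hasDerivAt_id s).smul_const h).const_add a
  have := h1.comp_hasDerivAt s h2
  have e : dphi q (a + s • h) h = ((q * ‖a + s • h‖ ^ (q - 2)) • innerSL ℝ (a + s • h)) h := by
    rw [dphi, real_inner_smul_left, _root_.smul_apply, innerSL_apply_apply, smul_eq_mul, mul_assoc]
  rw [e]
  exact this

lemma seg_norm_le {R s : ℝ} {z w : ℂ} (hz : ‖z‖ ≤ R) (hw : ‖w‖ ≤ R) (hs : s ∈ Set.Icc (0:ℝ) 1) :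
    ‖z + s • (w - z)‖ ≤ R := by
  have : z + s • (w - z) = (1 - s) • z + s • w := by module
  rw [this]
  calc _ ≤ ‖(1 - s) • z‖ + ‖s • w‖ := norm_add_le _ _
    _ = (1 - s) * ‖z‖ + s * ‖w‖ := by
      rw [norm_smul, norm_smul, Real.norm_of_nonneg hs.1, Real.norm_of_nonneg (by linarith [hs.2])]
    _ ≤ (1 - s) * R + s * R := by
      have := hs.1; have := hs.2
      gcongr
    _ = R := by ring

lemma hA3 {q R : ℝ} (hq : 2 ≤ q) {f1 f2 g1 g2 : ℂ} (hf1 : ‖f1‖ ≤ R) (hf2 : ‖f2‖ ≤ R)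
    (hg1 : ‖g1‖ ≤ R) (hg2 : ‖g2‖ ≤ R) :
    |(‖f2‖ ^ q - ‖f1‖ ^ q) - (‖g2‖ ^ q - ‖g1‖ ^ q)| ≤
      q * R ^ (q - 2) * (‖f1‖ + ‖f2‖) * ‖(f2 - g2) - (f1 - g1)‖ +
      q ^ 2 * R ^ (q - 2) * (‖f1 - g1‖ + ‖f2 - g2‖) * ‖g2 - g1‖ := by
  have hR : 0 ≤ R := (norm_nonneg _).trans hf1
  have key := Convex.norm_image_sub_le_of_norm_hasDerivWithin_le (𝕜 := ℝ) (s := Set.Icc (0:ℝ) 1)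
    (f := fun s : ℝ => ‖f1 + s • (f2 - f1)‖ ^ q - ‖g1 + s • (g2 - g1)‖ ^ q)
    (f' := fun s => dphi q (f1 + s • (f2 - f1)) (f2 - f1) - dphi q (g1 + s • (g2 - g1)) (g2 - g1))
    (x := 0) (y := 1)
    (C := q * R ^ (q - 2) * (‖f1‖ + ‖f2‖) * ‖(f2 - g2) - (f1 - g1)‖ +
      q ^ 2 * R ^ (q - 2) * (‖f1 - g1‖ + ‖f2 - g2‖) * ‖g2 - g1‖)
    (fun s _ => ((hasDerivAt_phi hq f1 (f2 - f1) s).sub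
      (hasDerivAt_phi hq g1 (g2 - g1) s)).hasDerivWithinAt) ?_ (convex_Icc 0 1) (by simp) (by simp)
  · simp only [one_smul, zero_smul, add_zero, add_sub_cancel, sub_zero, norm_one, mul_one,
      Real.norm_eq_abs] at key
    convert key using 2
    ring
  · intro s hs
    have hfs := seg_norm_le hf1 hf2 hs
    have hgs := seg_norm_le hg1 hg2 hs
    have hfs2 : ‖f1 + s • (f2 - f1)‖ ≤ ‖f1‖ + ‖f2‖ :=
      seg_norm_le (by linarith [norm_nonneg f2]) (by linarith [norm_nonneg f1]) hs
    have hd : ‖(f1 + s • (f2 - f1)) - (g1 + s • (g2 - g1))‖ ≤ ‖f1 - g1‖ + ‖f2 - g2‖ := by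
      have : (f1 + s • (f2 - f1)) - (g1 + s • (g2 - g1)) =
        (f1 - g1) + s • ((f2 - g2) - (f1 - g1)) := by module
      rw [this]
      exact seg_norm_le (by linarith [norm_nonneg (f2 - g2)]) (by linarith [norm_nonneg (f1 - g1)]) hs
    set F := f1 + s • (f2 - f1)
    set G := g1 + s • (g2 - g1)
    have e : dphi q F (f2 - f1) - dphi q G (g2 - g1) =
      dphi q F ((f2 - g2) - (f1 - g1)) + (dphi q F (g2 - g1) - dphi q G (g2 - g1)) := by
      have : (f2 - g2) - (f1 - g1) = (f2 - f1) - (g2 - g1) := by ring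
      rw [this, dphi_sub_right (w := f2 - f1)]; ring
    rw [Real.norm_eq_abs, e]
    refine (abs_add_le _ _).trans (add_le_add ?_ ?_)
    · refine (dphi_le hq hfs).trans ?_
      gcongr
    · refine (dphi_sub_le hq hfs hgs).trans ?_
      gcongr

lemma hA4 {q R : ℝ} (hq : 2 ≤ q) {a h : ℂ} (ha : ‖a‖ ≤ R) (hah : ‖a + h‖ ≤ R) :
    |‖a + h‖ ^ q - ‖a‖ ^ q - dphi q a h| ≤ q ^ 2 * R ^ (q - 2) * ‖h‖ ^ 2 := by
  have hR : 0 ≤ R := (norm_nonneg _).trans ha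
  have key := Convex.norm_image_sub_le_of_norm_hasDerivWithin_le (𝕜 := ℝ) (s := Set.Icc (0:ℝ) 1)
    (f := fun s : ℝ => ‖a + s • h‖ ^ q - s * dphi q a h)
    (f' := fun s => dphi q (a + s • h) h - 1 * dphi q a h)
    (x := 0) (y := 1)
    (C := q ^ 2 * R ^ (q - 2) * ‖h‖ ^ 2)
    (fun s _ => ((hasDerivAt_phi hq a h s).sub
      ((hasDerivAt_id s).mul_const _)).hasDerivWithinAt) ?_ (convex_Icc 0 1) (by simp) (by simp)
  · simp only [one_smul, zero_smul, add_zero, sub_zero, norm_one, mul_one,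
      Real.norm_eq_abs, one_mul, zero_mul] at key
    convert key using 2
    ring
  · intro s hs
    have hs1 : ‖a + s • h‖ ≤ R := by
      have := seg_norm_le ha hah hs
      rwa [add_sub_cancel_left] at this
    rw [Real.norm_eq_abs, one_mul]
    refine (dphi_sub_le hq hs1 ha).trans ?_
    rw [add_sub_cancel_left, norm_smul, Real.norm_of_nonneg hs.1]
    have : s * ‖h‖ ≤ ‖h‖ := mul_le_of_le_one_left (norm_nonneg _) hs.2
    calc _ ≤ q ^ 2 * R ^ (q - 2) * ‖h‖ * ‖h‖ := by gcongr
      _ = _ := by ring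


open scoped ContDiff in
lemma plancherel_aux {d : ℕ} {u : EuclideanSpace ℝ (Fin d) → ℂ} (h1 : Integrable u)
    (h2 : MemLp u 2) :
    (𝓕 (h2.toLp u) : Lp ℂ 2 (volume : Measure (EuclideanSpace ℝ (Fin d)))) =ᵐ[volume] 𝓕 u := by
  have hc : Continuous (𝓕 u) :=
    VectorFourier.fourierIntegral_continuous continuous_fourierChar
      (by exact continuous_inner) h1
  refine ae_eq_of_integral_contDiff_smul_eq ((Lp.memLp _).locallyIntegrable (by norm_num))
    hc.locallyIntegrable ?_
  intro g g_smooth g_cpt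
  have hg₁ : HasCompactSupport (Complex.ofRealCLM ∘ g) := g_cpt.comp_left rfl
  have hg₂ : ContDiff ℝ ∞ (Complex.ofRealCLM ∘ g) := by fun_prop
  set s := hg₁.toSchwartzMap hg₂ with hs
  have hsx : ∀ x, s x = (g x : ℂ) := fun x => by simp [hs]
  have e1 : ∫ x, g x • (𝓕 (h2.toLp u) : Lp ℂ 2 (volume : Measure (EuclideanSpace ℝ (Fin d)))) x
      = (Lp.toTemperedDistribution (𝓕 (h2.toLp u))) s := by
    rw [Lp.toTemperedDistribution_apply]
    congr 1
  rw [e1, ← Lp.fourier_toTemperedDistribution_eq, TemperedDistribution.fourier_apply,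
    Lp.toTemperedDistribution_apply]
  have e2 : ∫ x, (𝓕 s) x • (h2.toLp u) x = ∫ x, (𝓕 (s : EuclideanSpace ℝ (Fin d) → ℂ)) x • u x := by
    apply integral_congr_ae
    filter_upwards [h2.coeFn_toLp] with x hx
    rw [hx, SchwartzMap.fourier_coe]
  rw [e2]
  have := VectorFourier.integral_fourierIntegral_smul_eq_flip (L := innerₗ (EuclideanSpace ℝ (Fin d))) (μ := volume) (ν := volume)
    continuous_fourierChar (by exact continuous_inner) s.integrable h1
  rw [flip_innerₗ] at this
  refine Eq.trans this ?_
  congr 1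

lemma plancherel {d : ℕ} {u : EuclideanSpace ℝ (Fin d) → ℂ} (h1 : Integrable u)
    (h2 : MemLp u 2) : MemLp (𝓕 u) 2 ∧ eLpNorm (𝓕 u) 2 volume = eLpNorm u 2 volume := by
  have h := plancherel_aux h1 h2
  refine ⟨(memLp_congr_ae h).1 (Lp.memLp _), ?_⟩
  rw [← eLpNorm_congr_ae h, ← Lp.enorm_def, ← ofReal_norm, Lp.norm_fourier_eq, ofReal_norm, Lp.enorm_def]
  exact eLpNorm_congr_ae h2.coeFn_toLp

lemma cont_fourier {d : ℕ} {u : EuclideanSpace ℝ (Fin d) → ℂ} (h1 : Integrable u) :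
    Continuous (𝓕 u) :=
  VectorFourier.fourierIntegral_continuous continuous_fourierChar
      (by exact continuous_inner) h1

lemma integrable_gauss {d : ℕ} {η : ℝ} (hη : 0 < η) :
    Integrable (fun y : EuclideanSpace ℝ (Fin d) => rexp (-η * ‖y‖ ^ 2)) := by
  have := (GaussianFourier.integrable_cexp_neg_mul_sq_norm_add (V := EuclideanSpace ℝ (Fin d))
    (b := (η : ℂ)) (by simpa using hη) 0 0).norm
  refine this.congr (Eventually.of_forall fun y => ?_)
  simp only [Complex.norm_exp]
  congr 1
  norm_cast
  simp

lemma gdom {d : ℕ} {η : ℝ} (hη : 0 < η) : ∃ c > 0,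
    ∀ (u : EuclideanSpace ℝ (Fin d) → ℂ) (A : ℝ), 0 ≤ A → Continuous u →
      (∀ y, ‖u y‖ ≤ A * rexp (-η * ‖y‖ ^ 2)) →
      Integrable u ∧ (∀ ξ, ‖𝓕 u ξ‖ ≤ A * c) ∧ MemLp (𝓕 u) 2 ∧
        ∫ ξ, ‖𝓕 u ξ‖ ^ 2 ≤ (A * c) ^ 2 := by
  have hW := integrable_gauss (d := d) hη
  have hW2 := integrable_gauss (d := d) (η := 2 * η) (by positivity)
  set c1 := ∫ y : EuclideanSpace ℝ (Fin d), rexp (-η * ‖y‖ ^ 2)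
  set c2 := ∫ y : EuclideanSpace ℝ (Fin d), rexp (-(2 * η) * ‖y‖ ^ 2) with hc2
  have h1 : 0 ≤ c1 := integral_nonneg fun y => (exp_pos _).le
  have h2 : 0 ≤ c2 := integral_nonneg fun y => (exp_pos _).le
  refine ⟨1 + c1 + c2, by positivity, ?_⟩
  intro u A hA hu hb
  have hint : Integrable u := (hW.const_mul A).mono' hu.aestronglyMeasurable
    (Eventually.of_forall hb)
  have hsq : ∀ y, ‖u y‖ ^ 2 ≤ A ^ 2 * rexp (-(2 * η) * ‖y‖ ^ 2) := by
    intro y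
    calc ‖u y‖ ^ 2 ≤ (A * rexp (-η * ‖y‖ ^ 2)) ^ 2 := by gcongr; exact hb y
      _ = _ := by rw [mul_pow, ← Real.exp_nat_mul]; congr 2; push_cast; ring
  have hi2 : Integrable (fun y => ‖u y‖ ^ 2) := by
    refine (hW2.const_mul (A ^ 2)).mono' (by fun_prop) (Eventually.of_forall fun y => ?_)
    rw [Real.norm_of_nonneg (by positivity)]; exact hsq y
  have hm : MemLp u 2 := (memLp_two_iff_integrable_sq_norm hu.aestronglyMeasurable).2 hi2
  obtain ⟨p1, p2⟩ := plancherel hint hm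
  refine ⟨hint, ?_, p1, ?_⟩
  · intro ξ
    calc ‖𝓕 u ξ‖ ≤ ∫ y, ‖u y‖ := by
          apply VectorFourier.norm_fourierIntegral_le_integral_norm
      _ ≤ ∫ y, A * rexp (-η * ‖y‖ ^ 2) := by
          exact integral_mono hint.norm (hW.const_mul A) hb
      _ = A * c1 := integral_const_mul _ _
      _ ≤ _ := by gcongr; linarith
  · have e : ∫ ξ, ‖𝓕 u ξ‖ ^ 2 = ∫ y, ‖u y‖ ^ 2 := by
      have k1 := p1.eLpNorm_eq_integral_rpow_norm (by norm_num) (by norm_num)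
      have k2 := hm.eLpNorm_eq_integral_rpow_norm (by norm_num) (by norm_num)
      rw [p2, k2] at k1
      simp only [ENNReal.toReal_ofNat, Real.rpow_ofNat] at k1
      have n1 : 0 ≤ ∫ ξ, ‖𝓕 u ξ‖ ^ 2 := integral_nonneg fun _ => by positivity
      have n2 : 0 ≤ ∫ y, ‖u y‖ ^ 2 := integral_nonneg fun _ => by positivity
      rw [ENNReal.ofReal_eq_ofReal_iff (by positivity) (by positivity)] at k1
      exact (Real.rpow_left_injOn (x := (2:ℝ)⁻¹) (by norm_num)
        (by exact n2) (by exact n1) k1).symm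
    rw [e]
    calc ∫ y, ‖u y‖ ^ 2 ≤ ∫ y, A ^ 2 * rexp (-(2 * η) * ‖y‖ ^ 2) :=
          integral_mono hi2 (hW2.const_mul _) hsq
      _ = A ^ 2 * c2 := integral_const_mul _ _
      _ ≤ (A * (1 + c1 + c2)) ^ 2 := by
        rw [mul_pow]; gcongr; nlinarith [mul_nonneg h1 h2]

lemma prod_int {d : ℕ} {f g : EuclideanSpace ℝ (Fin d) → ℂ} (hf : MemLp f 2) (hg : MemLp g 2)
    {a b : ℝ} (ha : 0 ≤ a) (hb : 0 ≤ b) (h1 : ∫ ξ, ‖f ξ‖ ^ 2 ≤ a ^ 2) (h2 : ∫ ξ, ‖g ξ‖ ^ 2 ≤ b ^ 2) :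
    Integrable (fun ξ => ‖f ξ‖ * ‖g ξ‖) ∧ ∫ ξ, ‖f ξ‖ * ‖g ξ‖ ≤ a * b := by
  refine ⟨hf.norm.integrable_mul hg.norm, ?_⟩
  have := integral_mul_norm_le_Lp_mul_Lq (μ := volume) (f := f) (g := g) (p := 2) (q := 2)
    (by constructor <;> norm_num) (by simpa using hf) (by simpa using hg)
  refine this.trans ?_
  simp only [Real.rpow_ofNat]
  gcongr
  · rw [← Real.sqrt_eq_rpow]; exact (Real.sqrt_le_sqrt h1).trans (by rw [Real.sqrt_sq ha])
  · rw [← Real.sqrt_eq_rpow]; exact (Real.sqrt_le_sqrt h2).trans (by rw [Real.sqrt_sq hb])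

lemma int_rpow {d : ℕ} {f : EuclideanSpace ℝ (Fin d) → ℂ} (hc : Continuous f) (hf : MemLp f 2)
    {R q : ℝ} (hq : 2 ≤ q) (hR : ∀ ξ, ‖f ξ‖ ≤ R) : Integrable (fun ξ => ‖f ξ‖ ^ q) := by
  have hi : Integrable (fun ξ => ‖f ξ‖ ^ 2) :=
    (memLp_two_iff_integrable_sq_norm hf.1).1 hf
  refine (hi.const_mul (R ^ (q - 2))).mono' ?_ (Eventually.of_forall fun ξ => ?_)
  · exact (hc.norm.rpow_const fun _ => Or.inr (by linarith)).aestronglyMeasurable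
  · rw [Real.norm_of_nonneg (by positivity)]
    calc ‖f ξ‖ ^ q = ‖f ξ‖ ^ (q - 2) * ‖f ξ‖ ^ 2 := by
          rw [← Real.rpow_natCast, ← Real.rpow_add' (by positivity) (by push_cast; linarith)]
          congr 1; push_cast; ring
      _ ≤ _ := by
        exact mul_le_mul_of_nonneg_right (Real.rpow_le_rpow (by positivity) (hR ξ) (by linarith)) (by positivity)


lemma int_zero_of_antiper {f : ℝ → ℝ} (c : ℝ) (h1 : ∀ x, f (x + 1) = f x)
    (h2 : ∀ x, f (x + c) = - f x) : ∫ x in (0:ℝ)..1, f x = 0 := by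
  have hp : Function.Periodic f 1 := h1
  have e1 : ∫ x in (0:ℝ)..1, f (x + c) = ∫ x in (0:ℝ)..1, f x := by
    rw [intervalIntegral.integral_comp_add_right]
    have := hp.intervalIntegral_add_eq (0 + c) 0
    rw [zero_add] at this ⊢
    rw [add_comm 1 c, this, zero_add]
  have e2 : ∫ x in (0:ℝ)..1, f (x + c) = - ∫ x in (0:ℝ)..1, f x := by
    simp_rw [h2]; rw [intervalIntegral.integral_neg]
  linarith

noncomputable def Jint (q : ℝ) (N : ℕ) : ℝ :=
  ∫ x in (0:ℝ)..1, |cos (4 * π * x)| ^ (q - 2) * cos (4 * π * x) * cos (N * (4 * π * x))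

lemma cont_absrpow {q : ℝ} (hq : 2 < q) : Continuous fun x : ℝ => |cos (4 * π * x)| ^ (q - 2) := by
  apply Continuous.rpow_const
  · fun_prop
  · intro x; right; linarith

lemma Jint_rec {q : ℝ} (hq : 2 < q) (N : ℕ) :
    (q + N + 1) * Jint q (N + 2) = (q - 1 - N) * Jint q N := by
  have hc := cont_absrpow hq
  have hder : ∀ x : ℝ, HasDerivAt (fun x => |cos (4 * π * x)| ^ q * sin ((N + 1) * (4 * π * x)))
      (2 * π * ((q + N + 1) * (|cos (4 * π * x)| ^ (q - 2) * cos (4 * π * x) *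
        cos ((N + 2 : ℕ) * (4 * π * x))) - (q - 1 - N) * (|cos (4 * π * x)| ^ (q - 2) *
          cos (4 * π * x) * cos (N * (4 * π * x))))) x := by
    intro x
    have hl : HasDerivAt (fun x : ℝ => 4 * π * x) (4 * π) x := by
      simpa using (hasDerivAt_id x).const_mul (4 * π)
    have h1 := (hasDerivAt_abs_rpow (cos (4 * π * x)) (show 1 < q by linarith)).comp x hl.cos
    have h2 := (hl.const_mul ((N:ℝ) + 1)).sin
    have := h1.mul h2
    refine this.congr_deriv ?_
    simp only [Function.comp]
    have hsq : |cos (4 * π * x)| ^ q = |cos (4 * π * x)| ^ (q - 2) * cos (4 * π * x) ^ 2 := by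
      rcases eq_or_ne (cos (4 * π * x)) 0 with h | h
      · rw [h]; simp; rw [Real.zero_rpow (by linarith)]
      · have : 0 < |cos (4 * π * x)| := abs_pos.mpr h
        rw [← sq_abs, ← Real.rpow_natCast, ← Real.rpow_add this]; norm_num
    rw [hsq]
    set θ := 4 * π * x
    have e1 : cos ((N + 2 : ℕ) * θ) = cos ((N + 1) * θ) * cos θ - sin ((N + 1) * θ) * sin θ := by
      rw [← cos_add]; push_cast; ring_nf
    have e2 : cos (N * θ) = cos ((N + 1) * θ) * cos θ + sin ((N + 1) * θ) * sin θ := by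
      rw [← cos_sub]; ring_nf
    rw [e1, e2]
    ring
  have hint := intervalIntegral.integral_eq_sub_of_hasDerivAt (a := 0) (b := 1) (fun x _ => hder x)
    (by apply Continuous.intervalIntegrable; fun_prop)
  have hs : sin (((N:ℝ) + 1) * (4 * π * 1)) = 0 := by
    have : ((N:ℝ) + 1) * (4 * π * 1) = ((4 * (N + 1) : ℕ) : ℝ) * π := by push_cast; ring
    rw [this, sin_nat_mul_pi]
  rw [intervalIntegral.integral_const_mul, intervalIntegral.integral_sub,
    intervalIntegral.integral_const_mul, intervalIntegral.integral_const_mul, hs] at hint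
  · simp only [mul_zero, sin_zero, sub_zero, mul_eq_zero] at hint
    have hpi := pi_pos
    rcases hint with (h | h) | h
    · norm_num at h
    · exact absurd h hpi.ne'
    · unfold Jint; linarith
  · apply Continuous.intervalIntegrable; fun_prop
  · apply Continuous.intervalIntegrable; fun_prop

lemma Jint_one_pos {q : ℝ} (hq : 2 < q) : 0 < Jint q 1 := by
  have hc := cont_absrpow hq
  unfold Jint
  apply intervalIntegral.integral_pos (by norm_num)
  · apply Continuous.continuousOn; fun_prop
  · intro x _
    simp only [Nat.cast_one, one_mul, mul_assoc]
    exact mul_nonneg (by positivity) (mul_self_nonneg _)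
  · exact ⟨0, by simp, by simp⟩

lemma Jint_pos {q : ℝ} (hq : 2 < q) (j : ℕ) (hj : 2 * (j:ℝ) < q) : 0 < Jint q (2 * j + 1) := by
  induction j with
  | zero => simpa using Jint_one_pos hq
  | succ j ih =>
    push_cast at hj
    have h1 := ih (by linarith)
    have h2 := Jint_rec hq (2 * j + 1)
    push_cast at h2
    have h3 : 0 < (q - 1 - (2 * (j:ℝ) + 1)) * Jint q (2 * j + 1) := mul_pos (by linarith) h1
    rw [← h2] at h3
    exact (mul_pos_iff_of_pos_left (by positivity)).mp h3

lemma Jint_neg {q : ℝ} (hq : 2 < q) (k : ℕ) (hk : 2 * (k:ℝ) < q) (hk2 : q < 2 * (k:ℝ) + 2) :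
    Jint q (2 * k + 3) < 0 := by
  have h1 := Jint_pos hq k hk
  have h2 := Jint_rec hq (2 * k + 1)
  push_cast at h2
  have h3 : (q - 1 - (2 * (k:ℝ) + 1)) * Jint q (2 * k + 1) < 0 :=
    mul_neg_of_neg_of_pos (by linarith) h1
  rw [← h2] at h3
  have : 0 < q + (2 * (k:ℝ) + 1) + 1 := by positivity
  by_contra h
  push Not at h
  nlinarith [mul_nonneg this.le h]

/-- `e^{2πi x}` -/
noncomputable def ee (x : ℝ) : ℂ := Complex.exp ((2 * π * x : ℝ) * Complex.I)

lemma ee_add (x y : ℝ) : ee (x + y) = ee x * ee y := by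
  unfold ee; rw [← Complex.exp_add]; push_cast; ring_nf
lemma ee_nat (n : ℕ) : ee n = 1 := by
  unfold ee
  rw [Complex.exp_eq_one_iff]; exact ⟨n, by push_cast; ring⟩
lemma norm_ee (x : ℝ) : ‖ee x‖ = 1 := by
  unfold ee; exact Complex.norm_exp_ofReal_mul_I _
lemma ee_re (x : ℝ) : (ee x).re = cos (2 * π * x) := by
  unfold ee; exact Complex.exp_ofReal_mul_I_re _
lemma ee_im (x : ℝ) : (ee x).im = sin (2 * π * x) := by
  unfold ee; exact Complex.exp_ofReal_mul_I_im _
lemma cont_ee : Continuous ee := by unfold ee; fun_prop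
lemma inner_ee (x y : ℝ) : inner ℝ (ee x) (ee y) = cos (2 * π * (y - x)) := by
  rw [Complex.inner, Complex.mul_re, Complex.conj_re, Complex.conj_im, ee_re, ee_im, ee_re, ee_im]
  rw [mul_sub, cos_sub]; ring

lemma one_add_ee (x : ℝ) : 1 + ee (4 * x) = (2 * cos (4 * π * x)) • ee (2 * x) := by
  have h : 2 * π * (4 * x) = 2 * (4 * π * x) := by ring
  have h' : 2 * π * (2 * x) = 4 * π * x := by ring
  apply Complex.ext
  · simp only [Complex.add_re, Complex.one_re, Complex.real_smul, Complex.mul_re, Complex.ofReal_re,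
      Complex.ofReal_im, ee_re, ee_im, h, h', cos_two_mul]; ring
  · simp only [Complex.add_im, Complex.one_im, Complex.real_smul, Complex.mul_im, Complex.ofReal_re,
      Complex.ofReal_im, ee_re, ee_im, h, h', sin_two_mul]; ring

noncomputable def Ifun (q : ℝ) (k : ℕ) (r : ℝ) : ℝ :=
  ∫ x in (0:ℝ)..1, dphi q (1 + r • ee (4 * x)) (ee ((4 * k + 7 : ℕ) * x)) * cos (2 * π * x)

lemma cont_dphi_r {q : ℝ} (hq : 2 < q) (k : ℕ) : Continuous fun z : ℝ × ℝ =>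
    dphi q (1 + z.1 • ee (4 * z.2)) (ee ((4 * k + 7 : ℕ) * z.2)) * cos (2 * π * z.2) := by
  have := cont_ee
  have h1 : Continuous fun z : ℝ × ℝ => ‖1 + z.1 • ee (4 * z.2)‖ ^ (q - 2) := by
    apply Continuous.rpow_const
    · fun_prop
    · intro x; right; linarith
  unfold dphi
  fun_prop

lemma Ifun_cont {q : ℝ} (hq : 2 < q) (k : ℕ) : Continuous (Ifun q k) := by
  unfold Ifun
  apply intervalIntegral.continuous_parametric_intervalIntegral_of_continuous'
  exact cont_dphi_r hq k

lemma Ifun_one {q : ℝ} (hq : 2 < q) (k : ℕ) : Ifun q k 1 = q * 2 ^ (q - 2) * Jint q (2 * k + 3) := by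
  have hc := cont_absrpow hq
  have e : ∀ x : ℝ, dphi q (1 + (1:ℝ) • ee (4 * x)) (ee ((4 * k + 7 : ℕ) * x)) * cos (2 * π * x) =
      q * 2 ^ (q - 2) * (|cos (4 * π * x)| ^ (q - 2) * cos (4 * π * x) *
        cos ((2 * k + 3 : ℕ) * (4 * π * x))) +
      q * 2 ^ (q - 2) * (|cos (4 * π * x)| ^ (q - 2) * cos (4 * π * x) *
        cos ((2 * k + 2 : ℕ) * (4 * π * x))) := by
    intro x
    rw [one_smul, one_add_ee]
    unfold dphi
    rw [real_inner_smul_left, real_inner_smul_left, norm_smul, norm_ee, inner_ee, mul_one,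
      Real.norm_eq_abs, abs_mul, abs_two, Real.mul_rpow (by norm_num) (abs_nonneg _)]
    have e1 : cos ((2 * k + 3 : ℕ) * (4 * π * x)) + cos ((2 * k + 2 : ℕ) * (4 * π * x)) =
        2 * cos (2 * π * ((4 * k + 7 : ℕ) * x - 2 * x)) * cos (2 * π * x) := by
      rw [cos_add_cos]; push_cast; ring_nf
    linear_combination (-(q * 2 ^ (q - 2) * (|cos (4 * π * x)| ^ (q - 2) * cos (4 * π * x)))) * e1
  unfold Ifun
  simp_rw [e]
  rw [intervalIntegral.integral_add, intervalIntegral.integral_const_mul,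
    intervalIntegral.integral_const_mul]
  · have hz : ∫ x in (0:ℝ)..1, (|cos (4 * π * x)| ^ (q - 2) * cos (4 * π * x) *
        cos ((2 * k + 2 : ℕ) * (4 * π * x))) = 0 := by
      apply int_zero_of_antiper (1/4)
      · intro x
        have a1 : cos (4 * π * (x + 1)) = cos (4 * π * x) := by
          rw [← cos_add_nat_mul_two_pi (4 * π * x) 2]; push_cast; ring_nf
        have a2 : cos ((2 * k + 2 : ℕ) * (4 * π * (x + 1))) = cos ((2 * k + 2 : ℕ) * (4 * π * x)) := by
          rw [← cos_add_nat_mul_two_pi ((2 * k + 2 : ℕ) * (4 * π * x)) (4 * k + 4)]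
          push_cast; ring_nf
        rw [a1, a2]
      · intro x
        have a1 : cos (4 * π * (x + 1 / 4)) = - cos (4 * π * x) := by
          rw [← cos_add_pi]; ring_nf
        have a2 : cos ((2 * k + 2 : ℕ) * (4 * π * (x + 1 / 4))) =
            cos ((2 * k + 2 : ℕ) * (4 * π * x)) := by
          rw [← cos_add_nat_mul_two_pi ((2 * k + 2 : ℕ) * (4 * π * x)) (k + 1)]
          push_cast; ring_nf
        rw [a1, a2, abs_neg]; ring
    rw [hz, mul_zero, add_zero]
    rfl
  · apply Continuous.intervalIntegrable; fun_prop
  · apply Continuous.intervalIntegrable; fun_prop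

/-- The trigonometric polynomial. -/
noncomputable def PP (k : ℕ) (r s x : ℝ) : ℂ := 1 + r • ee (4 * x) + s • ee ((4 * k + 7 : ℕ) * x)

lemma cont_PP (k : ℕ) (r s : ℝ) : Continuous (PP k r s) := by
  have := cont_ee
  unfold PP; fun_prop

lemma exists_neg_pt {q : ℝ} (hq : 2 < q) (k : ℕ) {r s : ℝ} (hr0 : 0 < r) (hs0 : 0 < s)
    (hs1 : s < 1 - r) (x : ℝ) :
    ‖PP k r s x‖ ^ q * cos (2 * π * x) ≤ ‖1 + r • ee (4 * x)‖ ^ q * cos (2 * π * x) +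
      s * (dphi q (1 + r • ee (4 * x)) (ee ((4 * k + 7 : ℕ) * x)) * cos (2 * π * x)) +
      (q ^ 2 * 2 ^ (q - 2)) * s ^ 2 := by
  have n1 : ‖1 + r • ee (4 * x)‖ ≤ 1 + r := by
    refine (norm_add_le _ _).trans ?_
    rw [norm_smul, norm_ee, Real.norm_of_nonneg hr0.le]; simp
  have n2 : ‖1 + r • ee (4 * x) + s • ee ((4 * k + 7 : ℕ) * x)‖ ≤ 2 := by
    refine (norm_add_le _ _).trans ?_
    rw [norm_smul s, norm_ee, Real.norm_of_nonneg hs0.le]; linarith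
  have := hA4 hq.le (n1.trans (by linarith : 1 + r ≤ 2)) n2
  rw [norm_smul, norm_ee, Real.norm_of_nonneg hs0.le, mul_one] at this
  have hd : dphi q (1 + r • ee (4 * x)) (s • ee ((4 * k + 7 : ℕ) * x)) =
    s * dphi q (1 + r • ee (4 * x)) (ee ((4 * k + 7 : ℕ) * x)) := by
    unfold dphi; rw [real_inner_smul_right]; ring
  rw [hd] at this
  change |‖PP k r s x‖ ^ q - _ - _| ≤ (q ^ 2 * 2 ^ (q - 2)) * s ^ 2 at this
  set A := ‖PP k r s x‖ ^ q - ‖1 + r • ee (4 * x)‖ ^ q -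
    s * dphi q (1 + r • ee (4 * x)) (ee ((4 * k + 7 : ℕ) * x)) with hA
  have hc : A * cos (2 * π * x) ≤ (q ^ 2 * 2 ^ (q - 2)) * s ^ 2 := by
    refine (le_abs_self _).trans ?_
    rw [abs_mul]
    exact (mul_le_of_le_one_right (abs_nonneg _) (abs_cos_le_one _)).trans this
  rw [hA] at hc
  linarith

lemma exists_neg_zero (q r : ℝ) :
    ∫ x in (0:ℝ)..1, ‖1 + r • ee (4 * x)‖ ^ q * cos (2 * π * x) = 0 := by
  apply int_zero_of_antiper (1/2)
  · intro x
    have a1 : ee (4 * (x + 1)) = ee (4 * x) := by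
      rw [mul_add, ee_add]
      have := ee_nat 4
      push_cast at this
      rw [mul_one, this, mul_one]
    have a2 : cos (2 * π * (x + 1)) = cos (2 * π * x) := by
      rw [← cos_add_two_pi (2 * π * x)]; ring_nf
    rw [a1, a2]
  · intro x
    have a1 : ee (4 * (x + 1 / 2)) = ee (4 * x) := by
      rw [mul_add, ee_add]
      have := ee_nat 2
      push_cast at this
      rw [show (4:ℝ) * (1 / 2) = 2 by norm_num, this, mul_one]
    have a2 : cos (2 * π * (x + 1 / 2)) = - cos (2 * π * x) := by
      rw [← cos_add_pi (2 * π * x)]; ring_nf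
    rw [a1, a2]; ring

lemma cont_c1 {q : ℝ} (hq : 0 ≤ q) (r : ℝ) :
    Continuous fun x => ‖1 + r • ee (4 * x)‖ ^ q * cos (2 * π * x) := by
  have hcee := cont_ee
  have h1 : Continuous fun x => ‖1 + r • ee (4 * x)‖ := by fun_prop
  exact (h1.rpow_const (fun x => Or.inr hq)).mul (by fun_prop)

lemma cont_dphi_r2 {q : ℝ} (hq : 2 < q) (k : ℕ) (r : ℝ) : Continuous fun x : ℝ =>
    dphi q (1 + r • ee (4 * x)) (ee ((4 * k + 7 : ℕ) * x)) * cos (2 * π * x) := by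
  have := cont_ee
  have h0 : Continuous fun x : ℝ => ‖1 + r • ee (4 * x)‖ := by fun_prop
  have h1 : Continuous fun x : ℝ => ‖1 + r • ee (4 * x)‖ ^ (q - 2) :=
    h0.rpow_const (fun x => Or.inr (by linarith))
  unfold dphi
  fun_prop

lemma exists_neg {q : ℝ} (hq : 2 < q) (k : ℕ) (hk : 2 * (k:ℝ) < q) (hk2 : q < 2 * (k:ℝ) + 2) :
    ∃ r s : ℝ, 0 < r ∧ 0 < s ∧ r + s < 1 ∧
      ∫ x in (0:ℝ)..1, ‖PP k r s x‖ ^ q * cos (2 * π * x) < 0 := by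
  have h1 : Ifun q k 1 < 0 := by
    rw [Ifun_one hq]
    exact mul_neg_of_pos_of_neg (by positivity) (Jint_neg hq k hk hk2)
  obtain ⟨r, hr0, hr1, hr⟩ : ∃ r : ℝ, 0 < r ∧ r < 1 ∧ Ifun q k r < 0 := by
    have h2 : ∀ᶠ r in 𝓝[<] (1:ℝ), Ifun q k r < 0 :=
      ((Ifun_cont hq k).continuousAt.eventually_lt_const h1).filter_mono nhdsWithin_le_nhds
    have h3 : ∀ᶠ r in 𝓝[<] (1:ℝ), r ∈ Set.Ioo (0:ℝ) 1 := Ioo_mem_nhdsLT (by norm_num)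
    obtain ⟨r, hr, hr'⟩ := (h2.and h3).exists
    exact ⟨r, hr'.1, hr'.2, hr⟩
  obtain ⟨C, hC⟩ : ∃ C : ℝ, C = q ^ 2 * 2 ^ (q - 2) := ⟨_, rfl⟩
  have hC0 : 0 < C := by rw [hC]; positivity
  obtain ⟨s, hs0, hs1, hs⟩ : ∃ s : ℝ, 0 < s ∧ s < 1 - r ∧ s * C < - Ifun q k r := by
    refine ⟨min ((1 - r) / 2) (- Ifun q k r / (2 * C)), ?_, ?_, ?_⟩
    · apply lt_min (by linarith); apply div_pos (by linarith) (by positivity)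
    · exact (min_le_left _ _).trans_lt (by linarith)
    · calc _ ≤ - Ifun q k r / (2 * C) * C := by gcongr; exact min_le_right _ _
        _ = - Ifun q k r / 2 := by field_simp
        _ < _ := by linarith
  refine ⟨r, s, hr0, hs0, by linarith, ?_⟩
  have hpt : ∀ x, ‖PP k r s x‖ ^ q * cos (2 * π * x) ≤ ‖1 + r • ee (4 * x)‖ ^ q * cos (2 * π * x) +
      s * (dphi q (1 + r • ee (4 * x)) (ee ((4 * k + 7 : ℕ) * x)) * cos (2 * π * x)) + C * s ^ 2 := by
    rw [hC]
    exact exists_neg_pt hq k hr0 hs0 hs1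
  have c0 : Continuous fun x => ‖PP k r s x‖ ^ q * cos (2 * π * x) :=
    ((cont_PP k r s).norm.rpow_const (fun x => Or.inr (by linarith))).mul (by fun_prop)
  have c1 : Continuous fun x => ‖1 + r • ee (4 * x)‖ ^ q * cos (2 * π * x) :=
    cont_c1 (by linarith) r
  have c2 := cont_dphi_r2 hq k r
  have i0 := c0.intervalIntegrable (μ := volume) 0 1
  have i1 := c1.intervalIntegrable (μ := volume) 0 1
  have i2 := (c2.intervalIntegrable (μ := volume) 0 1).const_mul s
  have i3 : IntervalIntegrable (fun _ : ℝ => C * s ^ 2) volume 0 1 := intervalIntegrable_const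
  have hle := intervalIntegral.integral_mono_on (a := 0) (b := 1) (μ := volume) (by norm_num)
    i0 ((i1.add i2).add i3) (fun x _ => hpt x)
  rw [intervalIntegral.integral_add (i1.add i2) i3, intervalIntegral.integral_add i1 i2,
    intervalIntegral.integral_const_mul, exists_neg_zero q r, intervalIntegral.integral_const] at hle
  refine hle.trans_lt ?_
  have e : ∫ x in (0:ℝ)..1, dphi q (1 + r • ee (4 * x)) (ee ((4 * k + 7 : ℕ) * x)) *
    cos (2 * π * x) = Ifun q k r := rfl
  rw [e, sub_zero, one_smul, zero_add]
  nlinarith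


noncomputable def cn (f : ℝ → ℂ) (n : ℤ) : ℂ := ∫ x in (0:ℝ)..1, ee (-(n * x)) * f x

lemma fourier_eq_ee {T : ℝ} (hT : T = 1) (n : ℤ) (x : ℝ) :
    (fourier n (x : AddCircle T) : ℂ) = ee (n * x) := by
  subst hT
  rw [fourier_coe_apply]; unfold ee; push_cast; congr 1; ring

lemma cn_eq_On (f : ℝ → ℂ) (n : ℤ) : cn f n = fourierCoeffOn (zero_lt_one' ℝ) f n := by
  rw [fourierCoeffOn_eq_integral]
  simp only [sub_zero, div_one, one_smul, smul_eq_mul, cn]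
  congr 1; ext x
  rw [fourier_eq_ee (by simp)]; push_cast; ring_nf

lemma cn_deriv {f f' : ℝ → ℂ} (hf : ∀ x, HasDerivAt f (f' x) x) (hf' : Continuous f')
    (h01 : f 1 = f 0) {n : ℤ} (hn : n ≠ 0) : ‖cn f n‖ = ‖cn f' n‖ / (2 * π * |(n:ℝ)|) := by
  rw [cn_eq_On, cn_eq_On, fourierCoeffOn_of_hasDerivAt _ hn (fun x _ => hf x)
    (hf'.intervalIntegrable _ _), h01]
  simp only [sub_self, mul_zero, zero_sub, Complex.ofReal_one, Complex.ofReal_zero, sub_zero, one_mul]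
  rw [norm_mul, norm_neg]
  simp [abs_of_pos pi_pos]
  ring

lemma cn_bound {f : ℝ → ℂ} (hf : Continuous f) : ∃ C, ∀ n, ‖cn f n‖ ≤ C := by
  obtain ⟨C, hC⟩ := isCompact_Icc.exists_bound_of_continuousOn (s := Set.Icc (0:ℝ) 1) hf.continuousOn
  refine ⟨C, fun n => ?_⟩
  have := intervalIntegral.norm_integral_le_of_norm_le_const (a := (0:ℝ)) (b := 1)
    (f := fun x => ee (-(n * x)) * f x) (C := C) ?_
  · simpa [cn] using this
  · intro x hx
    rw [norm_mul, norm_ee, one_mul]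
    rw [Set.uIoc_of_le zero_le_one] at hx
    exact hC x ⟨hx.1.le, hx.2⟩

lemma per_deriv {f f' : ℝ → ℝ} (hf : ∀ x, HasDerivAt f (f' x) x) (hp : ∀ x, f (x + 1) = f x) (x : ℝ) :
    f' (x + 1) = f' x := by
  have h1 : HasDerivAt (fun x => f (x + 1)) (f' (x + 1)) x := (hf (x + 1)).comp_add_const x 1
  have h2 : (fun x => f (x + 1)) = f := funext hp
  rw [h2] at h1
  exact h1.unique (hf x)

lemma fourier_series {ψ : ℝ → ℝ} (hψ : ContDiff ℝ 2 ψ) (hp : ∀ x, ψ (x + 1) = ψ x) :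
    Summable (fun n => ‖cn (fun x => (ψ x : ℂ)) n‖) ∧
    ∀ x, HasSum (fun n : ℤ => cn (fun x => (ψ x : ℂ)) n * ee (n * x)) (ψ x : ℂ) := by
  have hd1 : ContDiff ℝ 1 (deriv ψ) := by
    have := (contDiff_succ_iff_deriv (n := 1) (f := ψ)).1 (by norm_num; exact hψ)
    exact this.2.2
  have h1 : ∀ x, HasDerivAt ψ (deriv ψ x) x := fun x =>
    (hψ.differentiable (by norm_num) x).hasDerivAt
  have h2 : ∀ x, HasDerivAt (deriv ψ) (deriv (deriv ψ) x) x := fun x =>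
    (hd1.differentiable (by norm_num) x).hasDerivAt
  have hc2 : Continuous (deriv (deriv ψ)) := hd1.continuous_deriv (by norm_num)
  have hp1 := per_deriv h1 hp
  set f : ℝ → ℂ := fun x => (ψ x : ℂ) with hf
  have hfc : Continuous f := Complex.continuous_ofReal.comp hψ.continuous
  obtain ⟨C, hC⟩ := cn_bound (f := fun x => ((deriv (deriv ψ) x : ℝ) : ℂ))
    (Complex.continuous_ofReal.comp hc2)
  have hsum : Summable (fun n => ‖cn f n‖) := by
    have hs : Summable (fun n : ℤ => (C / (2 * π) ^ 2) * (1 / (n:ℝ) ^ 2)) :=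
      (Real.summable_one_div_int_pow.mpr (by norm_num)).mul_left _
    refine Summable.of_norm_bounded_eventually hs ?_
    have : ∀ᶠ n : ℤ in cofinite, n ≠ 0 := (Set.finite_singleton (0:ℤ)).compl_mem_cofinite
    filter_upwards [this] with n hn
    rw [norm_norm, cn_deriv (fun x => (h1 x).ofReal_comp)
      (Complex.continuous_ofReal.comp hd1.continuous) (by have := hp 0; simp at this; simp [hf, this]) hn,
      cn_deriv (fun x => (h2 x).ofReal_comp)
      (Complex.continuous_ofReal.comp hc2) (by have := hp1 0; simp at this; simp [this]) hn]
    have := hC n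
    have hn' : 0 < |(n:ℝ)| := by positivity
    rw [div_div, ← sq_abs (n:ℝ)]
    calc _ ≤ C / (2 * π * |(n:ℝ)| * (2 * π * |(n:ℝ)|)) := by gcongr
      _ = _ := by field_simp
  refine ⟨hsum, fun x => ?_⟩
  have : Fact ((0:ℝ) < 1) := ⟨zero_lt_one⟩
  have hper : Function.Periodic f 1 := fun x => by simp [hf, hp]
  let F : C(AddCircle (1:ℝ), ℂ) := ⟨hper.lift, by
    exact continuous_coinduced_dom.mpr hfc⟩
  have hco : ∀ n, fourierCoeff F n = cn f n := by
    intro n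
    rw [fourierCoeff_eq_intervalIntegral _ _ 0]
    simp only [zero_add, div_one, one_smul, smul_eq_mul, cn]
    congr 1; ext x
    rw [fourier_eq_ee rfl]; push_cast
    rw [neg_mul]
    rfl
  have hs2 : Summable (fourierCoeff F) := by
    rw [funext hco]; exact hsum.of_norm
  have := has_pointwise_sum_fourier_series_of_summable hs2 (x : AddCircle (1:ℝ))
  simp_rw [hco, fourier_eq_ee rfl, smul_eq_mul] at this
  exact this

lemma PP_pos {k : ℕ} {r s : ℝ} (hr : 0 < r) (hs : 0 < s) (hrs : r + s < 1) (x : ℝ) :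
    0 < ‖PP k r s x‖ := by
  rw [norm_pos_iff]
  intro h
  have : (1:ℂ) = - (r • ee (4 * x) + s • ee ((4 * k + 7 : ℕ) * x)) := by
    unfold PP at h; linear_combination h
  have h2 : ‖(1:ℂ)‖ ≤ r + s := by
    rw [this, norm_neg]
    refine (norm_add_le _ _).trans ?_
    rw [norm_smul, norm_smul, norm_ee, norm_ee, Real.norm_of_nonneg hr.le, Real.norm_of_nonneg hs.le]
    linarith
  simp at h2
  linarith

lemma PP_contDiff {k : ℕ} {r s q : ℝ} (hr : 0 < r) (hs : 0 < s) (hrs : r + s < 1) :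
    ContDiff ℝ 2 (fun x => ‖PP k r s x‖ ^ q) := by
  have hP : ContDiff ℝ 2 (PP k r s) := by
    unfold PP ee
    have : ContDiff ℝ 2 (fun x : ℝ => (x : ℂ)) := Complex.ofRealCLM.contDiff
    have h : ∀ c : ℝ, ContDiff ℝ 2 (fun x : ℝ => Complex.exp ((2 * π * (c * x) : ℝ) * Complex.I)) := by
      intro c
      apply ContDiff.cexp
      apply ContDiff.mul _ contDiff_const
      exact this.comp (by fun_prop)
    exact (contDiff_const.add ((h 4).const_smul r)).add ((h _).const_smul s)
  exact (hP.norm ℝ (fun x => norm_pos_iff.mp (PP_pos hr hs hrs x))).rpow_const_of_ne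
    (fun x => (PP_pos hr hs hrs x).ne')

lemma PP_per (k : ℕ) (r s x : ℝ) : PP k r s (x + 1) = PP k r s x := by
  unfold PP
  have h4 := ee_nat 4
  push_cast at h4
  rw [mul_add, mul_add, ee_add, ee_add, mul_one, mul_one, h4, ee_nat, mul_one, mul_one]

lemma gauss_ee {d : ℕ} {τ : ℝ} (hτ : 0 < τ) (e : EuclideanSpace ℝ (Fin d)) (he : ‖e‖ = 1) (a : ℝ) :
    Integrable (fun ξ : EuclideanSpace ℝ (Fin d) => (rexp (-τ * ‖ξ‖ ^ 2) : ℂ) * ee (a * inner ℝ e ξ)) ∧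
    ∫ ξ : EuclideanSpace ℝ (Fin d), (rexp (-τ * ‖ξ‖ ^ 2) : ℂ) * ee (a * inner ℝ e ξ) =
      (((π / τ) ^ ((d:ℝ) / 2) * rexp (-(π ^ 2 / τ) * a ^ 2) : ℝ) : ℂ) := by
  have hfun : (fun ξ : EuclideanSpace ℝ (Fin d) => (rexp (-τ * ‖ξ‖ ^ 2) : ℂ) * ee (a * inner ℝ e ξ)) =
    fun ξ => Complex.exp (-(τ:ℂ) * ‖ξ‖ ^ 2 + (2 * π * a * Complex.I) * (inner ℝ e ξ : ℝ)) := by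
    ext ξ
    unfold ee
    rw [Complex.ofReal_exp, ← Complex.exp_add]; push_cast; ring_nf
  have hτ' : 0 < (τ:ℂ).re := by simpa using hτ
  rw [hfun]
  refine ⟨GaussianFourier.integrable_cexp_neg_mul_sq_norm_add hτ' _ _, ?_⟩
  rw [GaussianFourier.integral_cexp_neg_mul_sq_norm_add hτ']
  rw [he]
  have h1 : ((π:ℂ) / τ) ^ ((Module.finrank ℝ (EuclideanSpace ℝ (Fin d)) : ℂ) / 2) =
    (((π / τ) ^ ((d:ℝ) / 2) : ℝ) : ℂ) := by
    rw [Complex.ofReal_cpow (by positivity)]; simp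
  rw [h1, Complex.ofReal_mul, Complex.ofReal_exp]
  congr 2
  push_cast
  have : (τ:ℂ) ≠ 0 := by exact_mod_cast hτ.ne'
  field_simp
  rw [Complex.I_sq]; ring

lemma gauss_series {d : ℕ} {τ : ℝ} (hτ : 0 < τ) (e : EuclideanSpace ℝ (Fin d)) (he : ‖e‖ = 1)
    {ψ : ℝ → ℝ} {c : ℤ → ℂ} (hc : Summable fun n => ‖c n‖)
    (hψ : ∀ x, HasSum (fun n : ℤ => c n * ee (n * x)) (ψ x : ℂ)) (l : ℝ) :
    HasSum (fun n : ℤ => (π / τ) ^ ((d:ℝ) / 2) * ((c n).re * rexp (-(π ^ 2 / τ) * (n * l) ^ 2)))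
      (∫ ξ : EuclideanSpace ℝ (Fin d), rexp (-τ * ‖ξ‖ ^ 2) * ψ (l * inner ℝ e ξ)) := by
  have h := hasSum_integral_of_summable_integral_norm (μ := (volume : Measure (EuclideanSpace ℝ (Fin d))))
    (F := fun (n : ℤ) ξ => c n * ((rexp (-τ * ‖ξ‖ ^ 2) : ℂ) * ee ((n * l) * inner ℝ e ξ)))
    (fun n => (gauss_ee hτ e he _).1.const_mul _) ?_
  · simp_rw [integral_const_mul, (gauss_ee hτ e he _).2] at h
    have h2 : ∀ ξ : EuclideanSpace ℝ (Fin d),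
        ∑' n : ℤ, c n * ((rexp (-τ * ‖ξ‖ ^ 2) : ℂ) * ee ((n * l) * inner ℝ e ξ)) =
        ((rexp (-τ * ‖ξ‖ ^ 2) * ψ (l * inner ℝ e ξ) : ℝ) : ℂ) := by
      intro ξ
      have := ((hψ (l * inner ℝ e ξ)).mul_left (rexp (-τ * ‖ξ‖ ^ 2) : ℂ)).tsum_eq
      rw [Complex.ofReal_mul, ← this]
      congr 1; ext n
      rw [mul_assoc (n:ℝ)]; ring
    simp_rw [h2] at h
    rw [integral_complex_ofReal] at h
    have h3 := Complex.hasSum_re h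
    rw [Complex.ofReal_re] at h3
    convert h3 using 2 with n
    rw [Complex.re_mul_ofReal]; ring
  · simp_rw [norm_mul, norm_ee, mul_one, integral_const_mul]
    exact hc.mul_right _

lemma pow_diff {x y : ℝ} (hy : 0 ≤ y) (hxy : y ≤ x) (hx : x ≤ 1/2) {n : ℕ} (hn : 2 ≤ n) :
    x ^ n - y ^ n ≤ 2 * x * (x - y) := by
  obtain ⟨m, rfl⟩ := Nat.exists_eq_add_of_le hn
  clear hn
  have hx0 : 0 ≤ x := hy.trans hxy
  induction m with
  | zero => norm_num; nlinarith [sq_nonneg (x - y)]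
  | succ m ih =>
    have hym : y ^ (2 + m) ≤ x := by
      calc y ^ (2 + m) ≤ x ^ (2 + m) := by gcongr
        _ = x * x ^ (1 + m) := by ring
        _ ≤ x * 1 := by gcongr; exact pow_le_one₀ hx0 (by linarith)
        _ = x := mul_one x
    have e : x ^ (2 + (m + 1)) - y ^ (2 + (m + 1)) = x * (x ^ (2 + m) - y ^ (2 + m)) + y ^ (2 + m) * (x - y) := by ring
    rw [e]
    have h1 : x * (x ^ (2 + m) - y ^ (2 + m)) ≤ x * (2 * x * (x - y)) := by gcongr
    have h2 : y ^ (2 + m) * (x - y) ≤ x * (x - y) := by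
      apply mul_le_mul_of_nonneg_right hym; linarith
    have h3 : x * (2 * x * (x - y)) ≤ (1/2) * (2 * x * (x - y)) := by
      apply mul_le_mul_of_nonneg_right hx
      have : 0 ≤ x - y := by linarith
      positivity
    linarith

lemma main_lower {d : ℕ} {τ : ℝ} (hτ : 0 < τ) (e : EuclideanSpace ℝ (Fin d)) (he : ‖e‖ = 1)
    {ψ : ℝ → ℝ} {c : ℤ → ℂ} (hc : Summable fun n => ‖c n‖)
    (hψ : ∀ x, HasSum (fun n : ℤ => c n * ee (n * x)) (ψ x : ℂ))
    (h1 : (c 1).re < 0) (hm1 : (c (-1)).re ≤ 0) :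
    ∃ c0 > 0, ∃ L > 0, ∀ l₁ l₂ : ℝ, L ≤ l₁ → l₁ < l₂ →
      c0 * (rexp (-(π ^ 2 / τ) * l₁ ^ 2) - rexp (-(π ^ 2 / τ) * l₂ ^ 2)) ≤
      (∫ ξ : EuclideanSpace ℝ (Fin d), rexp (-τ * ‖ξ‖ ^ 2) * ψ (l₂ * inner ℝ e ξ)) -
      (∫ ξ : EuclideanSpace ℝ (Fin d), rexp (-τ * ‖ξ‖ ^ 2) * ψ (l₁ * inner ℝ e ξ)) := by
  set κ := π ^ 2 / τ with hκ
  have hκ0 : 0 < κ := by positivity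
  set Z := (π / τ) ^ ((d:ℝ) / 2) with hZ
  have hZ0 : 0 < Z := by positivity
  set S := ∑' n, |(c n).re| with hS
  have hγ : Summable fun n => |(c n).re| :=
    Summable.of_nonneg_of_le (fun n => abs_nonneg _) (fun n => Complex.abs_re_le_norm _) hc
  have hSum : HasSum (fun n => |(c n).re|) S := hγ.hasSum
  have hS0 : 0 ≤ S := tsum_nonneg (fun n => abs_nonneg _)
  -- choose L with x small
  have hlim : Tendsto (fun l : ℝ => rexp (-κ * l ^ 2)) atTop (𝓝 0) := by
    apply Real.tendsto_exp_atBot.comp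
    exact Tendsto.const_mul_atTop_of_neg (by linarith) (tendsto_pow_atTop (by norm_num))
  have hev : ∀ᶠ l : ℝ in atTop, rexp (-κ * l ^ 2) < 1/2 ∧ rexp (-κ * l ^ 2) * (4 * S) < -(c 1).re := by
    apply (hlim.eventually_lt_const (by norm_num)).and
    have := hlim.mul_const (4 * S)
    rw [zero_mul] at this
    exact this.eventually_lt_const (by linarith)
  obtain ⟨L0, hL0⟩ := eventually_atTop.mp hev
  refine ⟨Z * (-(c 1).re / 2), mul_pos hZ0 (by linarith), max L0 1, by positivity, ?_⟩
  intro l₁ l₂ hl hl2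
  obtain ⟨hx2, hxS⟩ := hL0 l₁ ((le_max_left _ _).trans hl)
  have hl1 : 1 ≤ l₁ := (le_max_right _ _).trans hl
  have hs1 := gauss_series hτ e he hc hψ l₁
  have hs2 := gauss_series hτ e he hc hψ l₂
  have hpow : ∀ (n : ℤ) (l : ℝ), rexp (-κ * (n * l) ^ 2) = rexp (-κ * l ^ 2) ^ (n.natAbs ^ 2) := by
    intro n l
    rw [← Real.exp_nat_mul]
    congr 1
    push_cast
    rw [Nat.cast_natAbs]
    push_cast
    rw [sq_abs]; ring
  rw [← hκ] at hs1 hs2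
  simp_rw [hpow, ← hZ] at hs1 hs2
  set x := rexp (-κ * l₁ ^ 2) with hx
  set y := rexp (-κ * l₂ ^ 2) with hy
  have hy0 : 0 < y := exp_pos _
  have hx0 : 0 < x := exp_pos _
  have hyx : y < x := by
    apply exp_lt_exp.mpr
    have : l₁ ^ 2 < l₂ ^ 2 := by gcongr
    nlinarith
  have hdiff := hs2.sub hs1
  have hlow : HasSum (fun n : ℤ => Z * (x - y) * ((if n = 1 then -(c 1).re else 0) - 2 * x * |(c n).re|))
      (Z * (x - y) * (-(c 1).re - 2 * x * S)) :=
    ((hasSum_ite_eq (1:ℤ) (-(c 1).re)).sub (hSum.mul_left _)).mul_left _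
  have hle := hasSum_le (fun n => ?_) hlow hdiff
  · refine le_trans ?_ hle
    have : Z * (-(c 1).re / 2) * (x - y) = Z * (x - y) * (-(c 1).re / 2) := by ring
    rw [this]
    apply mul_le_mul_of_nonneg_left
    · linarith
    · apply mul_nonneg hZ0.le; linarith
  · have e1 : Z * ((c n).re * y ^ n.natAbs ^ 2) - Z * ((c n).re * x ^ n.natAbs ^ 2) =
      Z * ((c n).re * (y ^ n.natAbs ^ 2 - x ^ n.natAbs ^ 2)) := by ring
    rw [e1, mul_assoc]
    apply mul_le_mul_of_nonneg_left _ hZ0.le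
    have hxy0 : 0 ≤ x - y := by linarith
    have hnn : 0 ≤ (x - y) * (2 * x * |(c n).re|) := by positivity
    by_cases hn1 : n = 1
    · subst hn1
      simp only [if_true, Int.natAbs_one, one_pow, pow_one]
      nlinarith
    rw [if_neg hn1]
    by_cases hn0 : n = 0
    · subst hn0
      simp only [Int.natAbs_zero]
      norm_num
      linarith
    by_cases hnm : n = -1
    · subst hnm
      have : 0 ≤ (c (-1)).re * (y - x) := mul_nonneg_of_nonpos_of_nonpos hm1 (by linarith)
      simp only [Int.natAbs_neg, Int.natAbs_one, one_pow, pow_one]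
      linarith
    have hN : 2 ≤ n.natAbs ^ 2 := by
      have : 2 ≤ n.natAbs := by omega
      nlinarith
    have hp := pow_diff hy0.le hyx.le hx2.le hN
    have hp0 : y ^ n.natAbs ^ 2 ≤ x ^ n.natAbs ^ 2 := by gcongr
    have ha : |(c n).re * (y ^ n.natAbs ^ 2 - x ^ n.natAbs ^ 2)| ≤ |(c n).re| * (2 * x * (x - y)) := by
      rw [abs_mul, abs_sub_comm, abs_of_nonneg (sub_nonneg.mpr hp0)]
      gcongr
    have := (abs_le.mp ha).1
    linarith

lemma main_lower_PP {d : ℕ} {τ : ℝ} (hτ : 0 < τ) (e : EuclideanSpace ℝ (Fin d)) (he : ‖e‖ = 1)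
    {q : ℝ} {k : ℕ} {r s : ℝ} (hr : 0 < r) (hs : 0 < s) (hrs : r + s < 1)
    (hneg : ∫ x in (0:ℝ)..1, ‖PP k r s x‖ ^ q * cos (2 * π * x) < 0) :
    ∃ c0 > 0, ∃ L > 0, ∀ l₁ l₂ : ℝ, L ≤ l₁ → l₁ < l₂ →
      c0 * (rexp (-(π ^ 2 / τ) * l₁ ^ 2) - rexp (-(π ^ 2 / τ) * l₂ ^ 2)) ≤
      (∫ ξ : EuclideanSpace ℝ (Fin d), rexp (-τ * ‖ξ‖ ^ 2) * ‖PP k r s (l₂ * inner ℝ e ξ)‖ ^ q) -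
      (∫ ξ : EuclideanSpace ℝ (Fin d), rexp (-τ * ‖ξ‖ ^ 2) * ‖PP k r s (l₁ * inner ℝ e ξ)‖ ^ q) := by
  have hcd := PP_contDiff (k := k) (q := q) hr hs hrs
  obtain ⟨h1, h2⟩ := fourier_series hcd (fun x => by rw [PP_per])
  have hre : ∀ n : ℤ, (n = 1 ∨ n = -1) → (cn (fun x => ((‖PP k r s x‖ ^ q : ℝ) : ℂ)) n).re =
      ∫ x in (0:ℝ)..1, ‖PP k r s x‖ ^ q * cos (2 * π * x) := by
    intro n hn
    unfold cn
    have hint : IntervalIntegrable (fun x : ℝ => ee (-(n * x)) * ((‖PP k r s x‖ ^ q : ℝ) : ℂ)) volume 0 1 := by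
      apply Continuous.intervalIntegrable
      exact (cont_ee.comp (by fun_prop)).mul (Complex.continuous_ofReal.comp hcd.continuous)
    have := Complex.reCLM.intervalIntegral_comp_comm hint
    simp only [Complex.reCLM_apply] at this
    rw [← this]
    congr 1; ext x
    rw [Complex.re_mul_ofReal, ee_re, mul_comm]
    congr 1
    rcases hn with rfl | rfl
    · rw [← cos_neg]; push_cast; ring_nf
    · push_cast; ring_nf
  refine main_lower hτ e he h1 h2 ?_ ?_
  · rw [hre 1 (Or.inl rfl)]; exact hneg
  · rw [hre (-1) (Or.inr rfl)]; exact hneg.le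


lemma err_bound {d : ℕ} {η q : ℝ} (hη : 0 < η) (hq : 2 ≤ q) : ∃ K > 0,
    ∀ (F1 F2 G1 G2 : EuclideanSpace ℝ (Fin d) → ℂ) (A B δ : ℝ), 0 ≤ A → 0 ≤ B → 0 ≤ δ →
      Continuous F1 → Continuous F2 → Continuous G1 → Continuous G2 →
      (∀ y, ‖F1 y‖ ≤ A * rexp (-η * ‖y‖ ^ 2)) → (∀ y, ‖F2 y‖ ≤ A * rexp (-η * ‖y‖ ^ 2)) →
      (∀ y, ‖G1 y‖ ≤ A * rexp (-η * ‖y‖ ^ 2)) → (∀ y, ‖G2 y‖ ≤ A * rexp (-η * ‖y‖ ^ 2)) →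
      (∀ y, ‖F1 y - G1 y‖ ≤ B * rexp (-η * ‖y‖ ^ 2)) →
      (∀ y, ‖F2 y - G2 y‖ ≤ B * rexp (-η * ‖y‖ ^ 2)) →
      (∀ y, ‖G2 y - G1 y‖ ≤ (A * δ) * rexp (-η * ‖y‖ ^ 2)) →
      (∀ y, ‖(F2 y - G2 y) - (F1 y - G1 y)‖ ≤ (B * δ) * rexp (-η * ‖y‖ ^ 2)) →
      Integrable (fun ξ => ‖𝓕 F1 ξ‖ ^ q) ∧
      |((∫ ξ, ‖𝓕 F2 ξ‖ ^ q) - ∫ ξ, ‖𝓕 F1 ξ‖ ^ q) - ((∫ ξ, ‖𝓕 G2 ξ‖ ^ q) - ∫ ξ, ‖𝓕 G1 ξ‖ ^ q)|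
        ≤ K * A ^ (q - 2) * A * B * δ := by
  obtain ⟨c, hc, H⟩ := gdom (d := d) hη
  refine ⟨(q * c ^ (q - 2) * 2 + q ^ 2 * c ^ (q - 2) * 2) * c ^ 2, by positivity, ?_⟩
  intro F1 F2 G1 G2 A B δ hA hB hδ cF1 cF2 cG1 cG2 bF1 bF2 bG1 bG2 bH1 bH2 bG bH
  obtain ⟨iF1, sF1, mF1, nF1⟩ := H F1 A hA cF1 bF1
  obtain ⟨iF2, sF2, mF2, nF2⟩ := H F2 A hA cF2 bF2
  obtain ⟨iG1, sG1, mG1, nG1⟩ := H G1 A hA cG1 bG1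
  obtain ⟨iG2, sG2, mG2, nG2⟩ := H G2 A hA cG2 bG2
  obtain ⟨iH1, -, mH1, nH1⟩ := H (F1 - G1) B hB (cF1.sub cG1) bH1
  obtain ⟨iH2, -, mH2, nH2⟩ := H (F2 - G2) B hB (cF2.sub cG2) bH2
  obtain ⟨-, -, mG, nG⟩ := H (G2 - G1) (A * δ) (by positivity) (cG2.sub cG1) bG
  obtain ⟨-, -, mH, nH⟩ := H ((F2 - G2) - (F1 - G1)) (B * δ) (by positivity)
    ((cF2.sub cG2).sub (cF1.sub cG1)) bH
  have fsub : ∀ (u v : EuclideanSpace ℝ (Fin d) → ℂ), Integrable u → Integrable v →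
      𝓕 (u - v) = 𝓕 u - 𝓕 v := fun u v hu hv => by
    ext ξ
    have := VectorFourier.fourierIntegral_add (L := innerₗ (EuclideanSpace ℝ (Fin d)))
      (μ := volume) continuous_fourierChar (by exact continuous_inner) (hu.sub hv) hv
    have h2 := congrFun this ξ
    rw [sub_add_cancel] at h2
    exact eq_sub_of_add_eq h2.symm
  rw [fsub _ _ (iF1) iG1] at mH1 nH1
  rw [fsub _ _ (iF2) iG2] at mH2 nH2
  rw [fsub _ _ (iG2) iG1] at mG nG
  rw [fsub _ _ (iH2) iH1, fsub _ _ iF1 iG1, fsub _ _ iF2 iG2] at mH nH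
  have jF1 := int_rpow (cont_fourier iF1) mF1 hq sF1
  have jF2 := int_rpow (cont_fourier iF2) mF2 hq sF2
  have jG1 := int_rpow (cont_fourier iG1) mG1 hq sG1
  have jG2 := int_rpow (cont_fourier iG2) mG2 hq sG2
  refine ⟨jF1, ?_⟩
  have hAc : 0 ≤ A * c := by positivity
  have hBc : 0 ≤ B * c := by positivity
  obtain ⟨p1, r1⟩ := prod_int mF1 mH hAc (by positivity) nF1 nH
  obtain ⟨p2, r2⟩ := prod_int mF2 mH hAc (by positivity) nF2 nH
  obtain ⟨p3, r3⟩ := prod_int mH1 mG hBc (by positivity) nH1 nG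
  obtain ⟨p4, r4⟩ := prod_int mH2 mG hBc (by positivity) nH2 nG
  rw [← integral_sub jF2 jF1, ← integral_sub jG2 jG1,
    ← integral_sub (by exact jF2.sub jF1) (by exact jG2.sub jG1)]
  set P := q * (A * c) ^ (q - 2) with hP
  set P' := q ^ 2 * (A * c) ^ (q - 2) with hP'
  have hP0 : 0 ≤ P := by positivity
  have hP0' : 0 ≤ P' := by positivity
  refine (norm_integral_le_of_norm_le (G := ℝ) (g := fun ξ =>
    P * (‖𝓕 F1 ξ‖ * ‖(𝓕 F2 - 𝓕 G2 - (𝓕 F1 - 𝓕 G1)) ξ‖ + ‖𝓕 F2 ξ‖ * ‖(𝓕 F2 - 𝓕 G2 - (𝓕 F1 - 𝓕 G1)) ξ‖)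
    + P' * (‖(𝓕 F1 - 𝓕 G1) ξ‖ * ‖(𝓕 G2 - 𝓕 G1) ξ‖ + ‖(𝓕 F2 - 𝓕 G2) ξ‖ * ‖(𝓕 G2 - 𝓕 G1) ξ‖))
    (((p1.add p2).const_mul P).add ((p3.add p4).const_mul P')) (Eventually.of_forall fun ξ => ?_)).trans ?_
  · have := hA3 hq (sF1 ξ) (sF2 ξ) (sG1 ξ) (sG2 ξ)
    rw [Real.norm_eq_abs]
    refine this.trans (le_of_eq ?_)
    simp only [Pi.sub_apply]
    ring
  · rw [integral_add (by exact (p1.add p2).const_mul P) (by exact (p3.add p4).const_mul P'),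
      integral_const_mul, integral_const_mul, integral_add (by exact p1) (by exact p2),
      integral_add (by exact p3) (by exact p4)]
    calc _ ≤ P * (A * c * (B * δ * c) + A * c * (B * δ * c))
          + P' * (B * c * (A * δ * c) + B * c * (A * δ * c)) := by gcongr
      _ = _ := by
        rw [hP, hP', Real.mul_rpow hA hc.le]; ring


/-- the p-sum -/
noncomputable def psum (p : ℝ) (b : Fin 3 → ℝ) : ℝ := (∑ i, b i ^ p) ^ (1 / p)

lemma psum_pow {p : ℝ} (hp : 1 ≤ p) {b : Fin 3 → ℝ} (hb : ∀ i, 0 < b i) :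
    psum p b ^ p = ∑ i, b i ^ p := by
  have : 0 ≤ ∑ i, b i ^ p := Finset.sum_nonneg fun i _ => (rpow_pos_of_pos (hb i) p).le
  rw [psum, ← rpow_mul this, one_div_mul_cancel (by linarith), rpow_one]

lemma psum_pos {p : ℝ} {b : Fin 3 → ℝ} (hb : ∀ i, 0 < b i) : 0 < psum p b :=
  rpow_pos_of_pos (Finset.sum_pos (fun i _ => rpow_pos_of_pos (hb i) p) ⟨0, by simp⟩) _

lemma le_psum {p : ℝ} (hp : 1 ≤ p) {b : Fin 3 → ℝ} (hb : ∀ i, 0 < b i) (i : Fin 3) :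
    b i ≤ psum p b := by
  rw [← Real.rpow_le_rpow_iff (hb i).le (psum_pos hb).le (by linarith : 0 < p), psum_pow hp hb]
  exact Finset.single_le_sum (f := fun i => b i ^ p)
    (fun i _ => (rpow_pos_of_pos (hb i) p).le) (Finset.mem_univ i)

lemma weight_le {p : ℝ} (hp : 1 ≤ p) {b : Fin 3 → ℝ} (hb : ∀ i, 0 < b i) (i : Fin 3) :
    (b i / psum p b) ^ (p - 1) ≤ 1 :=
  rpow_le_one (div_nonneg (hb i).le (psum_pos hb).le)
    ((div_le_one (psum_pos hb)).2 (le_psum hp hb i)) (by linarith)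

lemma weight_eq {p : ℝ} {b : Fin 3 → ℝ} (hb : ∀ i, 0 < b i) (i : Fin 3) :
    b i * (b i / psum p b) ^ (p - 1) = psum p b ^ (1 - p) * b i ^ p := by
  have h := hb i
  have hF := psum_pos (p := p) hb
  rw [div_rpow h.le hF.le, show 1 - p = -(p - 1) by ring, rpow_neg hF.le,
    show b i ^ p = b i * b i ^ (p - 1) by
      nth_rw 2 [← rpow_one (b i)]; rw [← rpow_add h]; congr 1; ring]
  field_simp

lemma weight_sum {p : ℝ} (hp : 1 ≤ p) {b : Fin 3 → ℝ} (hb : ∀ i, 0 < b i) :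
    ∑ i, b i * (b i / psum p b) ^ (p - 1) = psum p b := by
  simp_rw [weight_eq hb]
  rw [← Finset.mul_sum, ← psum_pow hp hb, ← rpow_add (psum_pos hb)]
  simp

lemma psum_le {p : ℝ} (hp : 1 ≤ p) {b : Fin 3 → ℝ} (hb : ∀ i, 0 < b i) :
    psum p b ≤ ∑ i, b i := by
  conv_lhs => rw [← weight_sum hp hb]
  exact Finset.sum_le_sum fun i _ => mul_le_of_le_one_right (hb i).le (weight_le hp hb i)

lemma sub_psum_le {p : ℝ} (hp : 1 ≤ p) {b : Fin 3 → ℝ} (hb : ∀ i, 0 < b i) {S : ℝ} (hS0 : 0 ≤ S)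
    (hS : ∀ i j, i ≠ j → √(b i * b j) ≤ S) : ∑ i, b i - psum p b ≤ 3 * S := by
  obtain ⟨j, -, hj⟩ := Finset.exists_max_image Finset.univ b ⟨0, by simp⟩
  have h1 := le_psum hp hb j
  have h2 : ∀ i, b i - (if i = j then b j else 0) ≤ S := by
    intro i
    split_ifs with h
    · subst h; simpa using hS0
    · rw [sub_zero]
      refine le_trans ?_ (hS i j h)
      apply Real.le_sqrt_of_sq_le
      nlinarith [hj i (by simp), hb i]
  have h3 := Finset.sum_le_sum (s := Finset.univ) fun i _ => h2 i
  rw [Finset.sum_sub_distrib] at h3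
  simp at h3
  linarith

lemma psum_hasDeriv {p : ℝ} (hp : 1 ≤ p) {b v : Fin 3 → ℝ} {B : ℝ → Fin 3 → ℝ} {l : ℝ}
    (hBl : B l = b) (hb : ∀ i, 0 < b i) (hd : ∀ i, HasDerivAt (fun l => B l i) (b i * v i) l) :
    HasDerivAt (fun l => psum p (B l)) (∑ i, b i * (b i / psum p b) ^ (p - 1) * v i) l := by
  have h1 : ∀ i, HasDerivAt (fun l => B l i ^ p) (b i * v i * p * b i ^ (p - 1)) l := by
    intro i
    have := (hd i).rpow_const (p := p) (Or.inl (by rw [hBl]; exact (hb i).ne'))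
    rwa [hBl] at this
  have h2 : HasDerivAt (fun l => ∑ i, B l i ^ p) (∑ i, b i * v i * p * b i ^ (p - 1)) l :=
    HasDerivAt.fun_sum fun i _ => h1 i
  have hpos : 0 < ∑ i, b i ^ p := Finset.sum_pos (fun i _ => rpow_pos_of_pos (hb i) p) ⟨0, by simp⟩
  have h3 := h2.rpow_const (p := 1 / p) (Or.inl (by rw [hBl]; exact hpos.ne'))
  refine h3.congr_deriv ?_
  rw [hBl]
  simp_rw [weight_eq hb]
  have e1 : (∑ i, b i ^ p) ^ (1 / p - 1) = psum p b ^ (1 - p) := by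
    rw [psum, ← rpow_mul hpos.le]; congr 1; field_simp
  rw [e1, Finset.sum_mul, Finset.sum_mul]
  refine Finset.sum_congr rfl fun i _ => ?_
  rw [show b i ^ p = b i * b i ^ (p - 1) by
      nth_rw 2 [← rpow_one (b i)]; rw [← rpow_add (hb i)]; congr 1; ring]
  field_simp

lemma psum_deriv_le {p : ℝ} (hp : 1 ≤ p) {b v : Fin 3 → ℝ} (hb : ∀ i, 0 < b i) {V : ℝ}
    (hv : ∀ i, |v i| ≤ V) :
    |∑ i, b i * (b i / psum p b) ^ (p - 1) * v i - ∑ i, b i * v i| ≤ V * (∑ i, b i - psum p b) := by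
  conv_rhs => rw [← weight_sum hp hb]
  rw [← Finset.sum_sub_distrib, ← Finset.sum_sub_distrib, Finset.mul_sum]
  refine (Finset.abs_sum_le_sum_abs _ _).trans (Finset.sum_le_sum fun i _ => ?_)
  rw [← sub_mul, abs_mul, abs_sub_comm, mul_comm]
  have : 0 ≤ b i - b i * (b i / psum p b) ^ (p - 1) := by
    have := mul_le_of_le_one_right (hb i).le (weight_le hp hb i)
    linarith
  rw [abs_of_nonneg this]
  gcongr
  exact hv i


/-- the Gaussian bumps -/
noncomputable def bb {d : ℕ} (p : ℝ) (a x : Fin 3 → ℝ) (e y : EuclideanSpace ℝ (Fin d)) (l : ℝ)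
    (i : Fin 3) : ℝ := a i * rexp (-(π / p) * ‖y - (l * x i) • e‖ ^ 2)

section
variable {d : ℕ} {p : ℝ} {a x : Fin 3 → ℝ} {e : EuclideanSpace ℝ (Fin d)}

lemma bb_pos (ha : ∀ i, 0 < a i) (y : EuclideanSpace ℝ (Fin d)) (l : ℝ) (i : Fin 3) :
    0 < bb p a x e y l i := mul_pos (ha i) (exp_pos _)

lemma bb_deriv (he : ‖e‖ = 1) (y : EuclideanSpace ℝ (Fin d)) (l : ℝ) (i : Fin 3) :
    HasDerivAt (fun l => bb p a x e y l i)
      (bb p a x e y l i * (2 * (π / p) * x i * (inner ℝ y e - l * x i))) l := by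
  have h0 : ∀ l : ℝ, ‖y - (l * x i) • e‖ ^ 2
      = ‖y‖ ^ 2 - 2 * (l * x i) * inner ℝ y e + (l * x i) ^ 2 := by
    intro l
    rw [norm_sub_sq_real, inner_smul_right, norm_smul, he, mul_one, Real.norm_eq_abs, sq_abs]; ring
  unfold bb
  simp_rw [h0]
  have h1 : HasDerivAt (fun l : ℝ => -(π / p) * (‖y‖ ^ 2 - 2 * (l * x i) * inner ℝ y e + (l * x i) ^ 2))
      (2 * (π / p) * x i * (inner ℝ y e - l * x i)) l := by
    have hl : HasDerivAt (fun l : ℝ => l * x i) (x i) l := by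
      simpa using (hasDerivAt_id l).mul_const (x i)
    have := ((((hl.const_mul 2).mul_const (inner ℝ y e)).const_sub (‖y‖ ^ 2)).add
      (hl.pow 2)).const_mul (-(π / p))
    refine this.congr_deriv ?_
    push_cast
    ring
  refine (h1.exp.const_mul (a i)).congr_deriv ?_
  ring

lemma norm_low (he : ‖e‖ = 1) {X : ℝ} (y : EuclideanSpace ℝ (Fin d)) {l z : ℝ}
    (hz : |z| ≤ X) : ‖y‖ ^ 2 / 2 - X ^ 2 * l ^ 2 ≤ ‖y - (l * z) • e‖ ^ 2 := by
  have h1 : ‖y‖ ≤ ‖y - (l * z) • e‖ + |l * z| := by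
    have := norm_add_le (y - (l * z) • e) ((l * z) • e)
    rwa [sub_add_cancel, norm_smul, he, mul_one, Real.norm_eq_abs] at this
  have h2 : ‖y‖ ^ 2 ≤ (‖y - (l * z) • e‖ + |l * z|) ^ 2 := by gcongr
  have h3 : |l * z| ^ 2 ≤ X ^ 2 * l ^ 2 := by
    rw [abs_mul, mul_pow, sq_abs, mul_comm]
    gcongr
  nlinarith [sq_nonneg (‖y - (l * z) • e‖ - |l * z|)]

lemma norm_low' (hp : 1 ≤ p) {η : ℝ} (hη : 0 < η) (hηp : 4 * η * p ≤ π) (he : ‖e‖ = 1) {X : ℝ}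
    (y : EuclideanSpace ℝ (Fin d)) {l z : ℝ}
    (hz : |z| ≤ X) : 2 * η * ‖y‖ ^ 2 - 4 * η * X ^ 2 * l ^ 2 ≤ (π / p) * ‖y - (l * z) • e‖ ^ 2 := by
  have h := norm_low he y (l := l) hz
  have h2 : 4 * η ≤ π / p := by rw [le_div_iff₀ (by linarith)]; exact hηp
  nlinarith [mul_le_mul_of_nonneg_right h2 (sq_nonneg ‖y - (l * z) • e‖)]

lemma bb_le (hp : 1 ≤ p) {η : ℝ} (hη : 0 < η) (hηp : 4 * η * p ≤ π) (he : ‖e‖ = 1) {X : ℝ}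
    (ha1 : ∀ i, a i ≤ 1) (hx : ∀ i, |x i| ≤ X)
    (y : EuclideanSpace ℝ (Fin d)) (l : ℝ) (i : Fin 3) :
    bb p a x e y l i ≤ rexp (-2 * η * ‖y‖ ^ 2 + 4 * η * X ^ 2 * l ^ 2) := by
  unfold bb
  calc _ ≤ 1 * rexp (-(π / p) * ‖y - (l * x i) • e‖ ^ 2) := by gcongr; exact ha1 i
    _ ≤ _ := by
      rw [one_mul, Real.exp_le_exp]
      linarith [norm_low' hp hη hηp he y (l := l) (hx i)]

lemma sqrt_bb_le (hp : 1 ≤ p) {η : ℝ} (hη : 0 < η) (hηp : 4 * η * p ≤ π) (he : ‖e‖ = 1) {X : ℝ}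
    (ha : ∀ i, 0 < a i) (ha1 : ∀ i, a i ≤ 1) (hx : ∀ i, |x i| ≤ X)
    (hgap : ∀ i j, i ≠ j → 4 ≤ |x i - x j|)
    (y : EuclideanSpace ℝ (Fin d)) (l : ℝ) (i j : Fin 3) (hij : i ≠ j) :
    √(bb p a x e y l i * bb p a x e y l j)
      ≤ rexp (-2 * η * ‖y‖ ^ 2 + 4 * η * X ^ 2 * l ^ 2 - 4 * (π / p) * l ^ 2) := by
  apply Real.sqrt_le_iff.2 ⟨(exp_pos _).le, ?_⟩
  unfold bb
  have hm : |(x i + x j) / 2| ≤ X := by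
    have := hx i; have := hx j
    rw [abs_le] at *
    constructor <;> linarith
  have h1 := norm_low' hp hη hηp he y (l := l) hm
  have h2 := parallelogram_law_with_norm ℝ (y - (l * x i) • e) (y - (l * x j) • e)
  have e1 : (y - (l * x i) • e) + (y - (l * x j) • e) = (2 : ℝ) • (y - (l * ((x i + x j) / 2)) • e) := by
    module
  have e2 : (y - (l * x i) • e) - (y - (l * x j) • e) = (l * (x j - x i)) • e := by module
  rw [e1, e2, norm_smul, norm_smul, he, mul_one, Real.norm_eq_abs, Real.norm_eq_abs, abs_mul,
    abs_two] at h2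
  have h3 : 16 * l ^ 2 ≤ |l| * |x j - x i| * (|l| * |x j - x i|) := by
    have hg := hgap j i hij.symm
    have : (4 * |l|) ^ 2 ≤ (|l| * |x j - x i|) ^ 2 := by
      refine pow_le_pow_left₀ (by positivity) ?_ 2; nlinarith [abs_nonneg l]
    rw [mul_pow, sq_abs] at this
    nlinarith
  have hpi : 0 < π / p := div_pos pi_pos (by linarith)
  calc a i * rexp (-(π / p) * ‖y - (l * x i) • e‖ ^ 2) * (a j * rexp (-(π / p) * ‖y - (l * x j) • e‖ ^ 2))
      ≤ 1 * rexp (-(π / p) * ‖y - (l * x i) • e‖ ^ 2) * (1 * rexp (-(π / p) * ‖y - (l * x j) • e‖ ^ 2)) := by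
        gcongr
        · have := ha j; positivity
        · exact ha1 i
        · exact ha1 j
    _ ≤ _ := by
      rw [one_mul, one_mul, ← Real.exp_add, ← Real.exp_nat_mul, Real.exp_le_exp]
      push_cast
      have h4 : (π / p) * (‖y - (l * x i) • e‖ ^ 2 + ‖y - (l * x j) • e‖ ^ 2)
        ≥ (π / p) * (2 * ‖y - (l * ((x i + x j) / 2)) • e‖ ^ 2 + 8 * l ^ 2) := by
        refine mul_le_mul_of_nonneg_left ?_ hpi.le
        nlinarith
      linarith

/-- G -/
noncomputable def GG (p : ℝ) (a x : Fin 3 → ℝ) (e : EuclideanSpace ℝ (Fin d)) (l : ℝ)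
    (y : EuclideanSpace ℝ (Fin d)) : ℝ := ∑ i, bb p a x e y l i
/-- F -/
noncomputable def FF (p : ℝ) (a x : Fin 3 → ℝ) (e : EuclideanSpace ℝ (Fin d)) (l : ℝ)
    (y : EuclideanSpace ℝ (Fin d)) : ℝ := psum p (bb p a x e y l)

lemma cont_bb (l : ℝ) (i : Fin 3) : Continuous (fun y => bb p a x e y l i) := by
  unfold bb; fun_prop

lemma cont_GG (l : ℝ) : Continuous (GG p a x e l) := by
  unfold GG; exact continuous_finsetSum _ fun i _ => cont_bb l i

lemma cont_FF (hp : 1 ≤ p) (ha : ∀ i, 0 < a i) (l : ℝ) : Continuous (FF p a x e l) := by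
  unfold FF psum
  have : Continuous fun y => ∑ i, bb p a x e y l i ^ p :=
    continuous_finsetSum _ fun i _ => (cont_bb l i).rpow_const fun y => Or.inl (bb_pos ha y l i).ne'
  exact this.rpow_const fun y => Or.inr (by positivity)

lemma lin_exp {η z : ℝ} (hη : 0 < η) : z ≤ (1 + 1 / η) * rexp (η * z ^ 2) := by
  have h1 := Real.add_one_le_exp (η * z ^ 2)
  have h2 : z ≤ (1 + 1 / η) * (η * z ^ 2 + 1) := by
    have : (1 + 1 / η) * (η * z ^ 2 + 1) = η * z ^ 2 + 1 + z ^ 2 + 1 / η := by field_simp; ring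
    rw [this]
    have : 0 < 1 / η := by positivity
    nlinarith [sq_nonneg (z - 1), mul_nonneg hη.le (sq_nonneg z)]
  exact h2.trans (by gcongr)

lemma pointwise (hp : 1 ≤ p) {η : ℝ} (hη : 0 < η) (hηp : 4 * η * p ≤ π) (he : ‖e‖ = 1) {X : ℝ}
    (ha : ∀ i, 0 < a i) (ha1 : ∀ i, a i ≤ 1) (hx : ∀ i, |x i| ≤ X)
    (hgap : ∀ i j, i ≠ j → 4 ≤ |x i - x j|) : ∃ C > 0, ∀ l y, 0 ≤ l →
    0 ≤ FF p a x e l y ∧ 0 ≤ GG p a x e l y ∧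
    FF p a x e l y ≤ GG p a x e l y ∧
    GG p a x e l y ≤ C * rexp ((4 * X ^ 2 + 1) * η * l ^ 2) * rexp (-η * ‖y‖ ^ 2) ∧
    |FF p a x e l y - GG p a x e l y| ≤
      C * rexp (((4 * X ^ 2 + 1) * η - 4 * (π / p)) * l ^ 2) * rexp (-η * ‖y‖ ^ 2) ∧
    (∃ g', HasDerivAt (fun l => GG p a x e l y) g' l ∧
      |g'| ≤ C * rexp ((4 * X ^ 2 + 1) * η * l ^ 2) * rexp (-η * ‖y‖ ^ 2)) ∧
    (∃ h', HasDerivAt (fun l => FF p a x e l y - GG p a x e l y) h' l ∧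
      |h'| ≤ C * rexp (((4 * X ^ 2 + 1) * η - 4 * (π / p)) * l ^ 2) * rexp (-η * ‖y‖ ^ 2)) := by
  have hX : 0 ≤ X := (abs_nonneg _).trans (hx 0)
  have hpi : 0 < π / p := div_pos pi_pos (by linarith)
  set D := 2 * (π / p) * X * (1 + X) * (2 * (1 + 1 / η)) with hD
  have hD0 : 0 ≤ D := by positivity
  refine ⟨3 * D + 3, by positivity, ?_⟩
  intro l y hl
  have hb := bb_pos (p := p) (x := x) (e := e) ha y l
  have hy0 : 1 ≤ rexp (η * ‖y‖ ^ 2) := Real.one_le_exp (by positivity)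
  have hl0 : 1 ≤ rexp (η * l ^ 2) := Real.one_le_exp (by positivity)
  have hE1 : 1 ≤ rexp (η * ‖y‖ ^ 2) * rexp (η * l ^ 2) := by nlinarith
  set v : Fin 3 → ℝ := fun i => 2 * (π / p) * x i * (inner ℝ y e - l * x i) with hv
  have hvb : ∀ i, |v i| ≤ D * (rexp (η * ‖y‖ ^ 2) * rexp (η * l ^ 2)) := by
    intro i
    have h1 : |inner ℝ y e - l * x i| ≤ (1 + X) * (‖y‖ + l) := by
      have h1 := abs_real_inner_le_norm y e
      rw [he, mul_one] at h1
      have h2 := abs_sub (inner ℝ y e) (l * x i)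
      rw [abs_mul, abs_of_nonneg hl] at h2
      have := mul_le_mul_of_nonneg_left (hx i) hl
      nlinarith [norm_nonneg y]
    have h2 : ‖y‖ + l ≤ 2 * (1 + 1 / η) * (rexp (η * ‖y‖ ^ 2) * rexp (η * l ^ 2)) := by
      have q1 := lin_exp (z := ‖y‖) hη
      have q2 := lin_exp (z := l) hη
      have q3 : rexp (η * ‖y‖ ^ 2) + rexp (η * l ^ 2) ≤ 2 * (rexp (η * ‖y‖ ^ 2) * rexp (η * l ^ 2)) := by
        nlinarith [mul_nonneg (sub_nonneg.2 hy0) (sub_nonneg.2 hl0)]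
      have q4 : 0 < 1 + 1 / η := by positivity
      nlinarith
    calc |v i| = 2 * (π / p) * |x i| * |inner ℝ y e - l * x i| := by
          simp only [hv, abs_mul, abs_two, abs_of_pos hpi]
      _ ≤ 2 * (π / p) * X * ((1 + X) * (2 * (1 + 1 / η) * (rexp (η * ‖y‖ ^ 2) * rexp (η * l ^ 2)))) := by
          gcongr
          · exact hx i
          · exact h1.trans (by gcongr)
      _ = _ := by rw [hD]; ring
  have hbl : ∀ i, bb p a x e y l i ≤ _ := bb_le hp hη hηp he ha1 hx y l
  have hdiff := sub_psum_le hp hb (exp_pos _).le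
    (fun i j hij => sqrt_bb_le hp hη hηp he ha ha1 hx hgap y l i j hij)
  have hle := psum_le hp hb
  have k1 : rexp (η * ‖y‖ ^ 2) * rexp (η * l ^ 2) * rexp (-2 * η * ‖y‖ ^ 2 + 4 * η * X ^ 2 * l ^ 2)
      = rexp ((4 * X ^ 2 + 1) * η * l ^ 2) * rexp (-η * ‖y‖ ^ 2) := by
    simp only [← Real.exp_add]; congr 1; ring
  have k2 : rexp (η * ‖y‖ ^ 2) * rexp (η * l ^ 2)
      * rexp (-2 * η * ‖y‖ ^ 2 + 4 * η * X ^ 2 * l ^ 2 - 4 * (π / p) * l ^ 2)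
      = rexp (((4 * X ^ 2 + 1) * η - 4 * (π / p)) * l ^ 2) * rexp (-η * ‖y‖ ^ 2) := by
    simp only [← Real.exp_add]; congr 1; ring
  have hG3 : ∑ i, bb p a x e y l i ≤ 3 * rexp (-2 * η * ‖y‖ ^ 2 + 4 * η * X ^ 2 * l ^ 2) := by
    have := Finset.sum_le_sum (s := Finset.univ) fun i _ => hbl i
    simpa using this
  simp only [mul_assoc (3 * D + 3)]
  rw [← k1, ← k2]
  set E := rexp (η * ‖y‖ ^ 2) * rexp (η * l ^ 2)
  set S1 := rexp (-2 * η * ‖y‖ ^ 2 + 4 * η * X ^ 2 * l ^ 2) with hS1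
  set S2 := rexp (-2 * η * ‖y‖ ^ 2 + 4 * η * X ^ 2 * l ^ 2 - 4 * (π / p) * l ^ 2) with hS2
  have p1 : 0 < S1 := exp_pos _
  have p2 : 0 < S2 := exp_pos _
  have b1 : 3 * S1 ≤ (3 * D + 3) * (E * S1) := by nlinarith [mul_le_mul_of_nonneg_right hE1 p1.le, mul_nonneg hD0 (mul_nonneg (zero_le_one.trans hE1) p1.le)]
  have b2 : 3 * S2 ≤ (3 * D + 3) * (E * S2) := by nlinarith [mul_le_mul_of_nonneg_right hE1 p2.le, mul_nonneg hD0 (mul_nonneg (zero_le_one.trans hE1) p2.le)]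
  have dG : HasDerivAt (fun l => GG p a x e l y) (∑ i, bb p a x e y l i * v i) l :=
    HasDerivAt.fun_sum fun i _ => bb_deriv he y l i
  refine ⟨(psum_pos hb).le, Finset.sum_nonneg fun i _ => (hb i).le, hle, hG3.trans b1, ?_,
    ⟨_, dG, ?_⟩, ⟨_, (psum_hasDeriv hp (v := v) rfl hb (fun i => bb_deriv he y l i)).sub dG, ?_⟩⟩
  · rw [abs_sub_comm, abs_of_nonneg (sub_nonneg.2 (by exact hle))]
    exact hdiff.trans b2
  · refine (Finset.abs_sum_le_sum_abs _ _).trans ?_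
    have : ∑ i, |bb p a x e y l i * v i| ≤ ∑ i, bb p a x e y l i * (D * E) := by
      refine Finset.sum_le_sum fun i _ => ?_
      rw [abs_mul, abs_of_pos (hb i)]
      exact mul_le_mul_of_nonneg_left (hvb i) (hb i).le
    rw [← Finset.sum_mul] at this
    refine this.trans ?_
    have hE0 : 0 ≤ E := zero_le_one.trans hE1
    calc _ ≤ 3 * S1 * (D * E) := by gcongr
      _ ≤ _ := by nlinarith [mul_nonneg hE0 p1.le]
  · refine (psum_deriv_le hp hb hvb).trans ?_
    have hE0 : 0 ≤ E := zero_le_one.trans hE1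
    calc _ ≤ D * E * (3 * S2) := by gcongr
      _ ≤ _ := by nlinarith [mul_nonneg hE0 p2.le]
end


lemma bb_eq {d : ℕ} {p : ℝ} {a x : Fin 3 → ℝ} {e : EuclideanSpace ℝ (Fin d)} (l : ℝ) (i : Fin 3)
    (y : EuclideanSpace ℝ (Fin d)) : (bb p a x e y l i : ℂ) =
      a i * Complex.exp (-((π / p : ℝ) : ℂ) * ‖y + -((l * x i) • e)‖ ^ 2) := by
  unfold bb; rw [← sub_eq_add_neg]; push_cast; rfl

lemma integrable_bb {d : ℕ} {p : ℝ} (hp : 0 < p) {a x : Fin 3 → ℝ} {e : EuclideanSpace ℝ (Fin d)}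
    (l : ℝ) (i : Fin 3) : Integrable (fun y => (bb p a x e y l i : ℂ)) := by
  simp_rw [bb_eq]
  have := (GaussianFourier.integrable_cexp_neg_mul_sq_norm_add (V := EuclideanSpace ℝ (Fin d))
    (b := ((π / p : ℝ) : ℂ)) (by rw [Complex.ofReal_re]; positivity) 0 0)
  simp only [zero_mul, add_zero] at this
  exact (this.comp_add_right (-((l * x i) • e))).const_mul _

lemma fourier_bb {d : ℕ} {p : ℝ} (hp : 0 < p) {a x : Fin 3 → ℝ} {e : EuclideanSpace ℝ (Fin d)}
    (l : ℝ) (i : Fin 3) (ξ : EuclideanSpace ℝ (Fin d)) :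
    𝓕 (fun y => (bb p a x e y l i : ℂ)) ξ =
      ((p ^ ((d : ℝ) / 2) * rexp (-π * p * ‖ξ‖ ^ 2) : ℝ) : ℂ) * (a i • ee (-(x i * (l * inner ℝ e ξ)))) := by
  simp_rw [bb_eq]
  set f : EuclideanSpace ℝ (Fin d) → ℂ := fun y => Complex.exp (-((π / p : ℝ) : ℂ) * ‖y‖ ^ 2) with hf
  have h1 : (fun y => (a i : ℂ) * Complex.exp (-((π / p : ℝ) : ℂ) * ‖y + -((l * x i) • e)‖ ^ 2))
      = (a i : ℂ) • (f ∘ fun v => v + -((l * x i) • e)) := by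
    ext y; simp [hf]
  rw [h1]
  have h2 : 𝓕 ((a i : ℂ) • (f ∘ fun v => v + -((l * x i) • e))) ξ
      = (a i : ℂ) • 𝓕 (f ∘ fun v => v + -((l * x i) • e)) ξ := by
    have := VectorFourier.fourierIntegral_const_smul 𝐞 (volume : Measure (EuclideanSpace ℝ (Fin d)))
      (innerₗ _) (f ∘ fun v => v + -((l * x i) • e)) (a i : ℂ)
    exact congrFun this ξ
  have h3 : 𝓕 (f ∘ fun v => v + -((l * x i) • e)) ξ = 𝐞 (inner ℝ (-((l * x i) • e)) ξ) • 𝓕 f ξ := by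
    have := VectorFourier.fourierIntegral_comp_add_right 𝐞
      (volume : Measure (EuclideanSpace ℝ (Fin d))) (innerₗ _) f (-((l * x i) • e))
    exact congrFun this ξ
  have h4 : 𝓕 f ξ = ((p ^ ((d : ℝ) / 2) * rexp (-π * p * ‖ξ‖ ^ 2) : ℝ) : ℂ) := by
    rw [hf, fourier_gaussian_innerProductSpace (by rw [Complex.ofReal_re]; positivity)]
    rw [finrank_euclideanSpace_fin]
    have hpi := pi_pos.ne'
    rw [← Complex.ofReal_div, show π / (π / p) = p by field_simp]
    rw [Complex.ofReal_mul, Complex.ofReal_cpow hp.le]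
    congr 1
    · push_cast; rfl
    · push_cast
      congr 1
      have : (p : ℂ) ≠ 0 := by exact_mod_cast hp.ne'
      field_simp
  rw [h2, h3, h4, Circle.smul_def, Real.fourierChar_apply, inner_neg_left, inner_smul_left]
  unfold ee
  simp only [smul_eq_mul, Complex.real_smul]
  rw [mul_comm (Complex.exp _), ← mul_assoc, mul_comm (a i : ℂ), mul_assoc]
  congr 5
  simp; ring

lemma ee_neg (x : ℝ) : ee (-x) = (starRingEnd ℂ) (ee x) := by
  unfold ee; rw [← Complex.exp_conj, map_mul, Complex.conj_ofReal, Complex.conj_I]; push_cast; ring_nf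

lemma fourier_GG {d : ℕ} {p q : ℝ} (hp : 0 < p) {e : EuclideanSpace ℝ (Fin d)} (k : ℕ) (r s : ℝ)
    (l : ℝ) (ξ : EuclideanSpace ℝ (Fin d)) :
    ‖𝓕 (fun y => (GG p ![1, r, s] ![0, 4, (4 * k + 7 : ℕ)] e l y : ℂ)) ξ‖ ^ q =
      (p ^ ((d : ℝ) / 2)) ^ q * (rexp (-(π * p * q) * ‖ξ‖ ^ 2) * ‖PP k r s (l * inner ℝ e ξ)‖ ^ q) := by
  set a : Fin 3 → ℝ := ![1, r, s] with ha
  set x : Fin 3 → ℝ := ![0, 4, (4 * k + 7 : ℕ)] with hx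
  have h1 : 𝓕 (fun y => (GG p a x e l y : ℂ)) ξ = ∑ i, 𝓕 (fun y => (bb p a x e y l i : ℂ)) ξ := by
    simp only [Real.fourier_eq, GG]
    rw [← integral_finsetSum]
    · congr 1; ext v; push_cast; rw [Finset.smul_sum]
    · intro i _
      exact (Real.fourierIntegral_convergent_iff ξ).2 (integrable_bb hp l i)
  have h2 : ∑ i, 𝓕 (fun y => (bb p a x e y l i : ℂ)) ξ =
      ((p ^ ((d : ℝ) / 2) * rexp (-π * p * ‖ξ‖ ^ 2) : ℝ) : ℂ) *
        (starRingEnd ℂ) (PP k r s (l * inner ℝ e ξ)) := by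
    simp_rw [fourier_bb hp]
    rw [← Finset.mul_sum]
    congr 1
    rw [Fin.sum_univ_three]
    simp only [ha, hx, PP, ee_neg]
    simp [ee]
  rw [h1, h2, norm_mul, RCLike.norm_conj, Complex.norm_real, Real.norm_of_nonneg (by positivity),
    Real.mul_rpow (by positivity) (by positivity), Real.mul_rpow (by positivity) (by positivity),
    ← Real.exp_mul]
  rw [mul_assoc]; congr 3; ring


/-- the measure -/
noncomputable def mm {d : ℕ} (p : ℝ) (a x : Fin 3 → ℝ) (e : EuclideanSpace ℝ (Fin d)) :
    Measure (EuclideanSpace ℝ (Fin d)) :=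
  ∑ i, ENNReal.ofReal (a i ^ p) • Measure.dirac (x i • e)

lemma mm_finite {d : ℕ} (p : ℝ) (a x : Fin 3 → ℝ) (e : EuclideanSpace ℝ (Fin d)) :
    IsFiniteMeasure (mm p a x e) := by
  constructor
  simp [mm]

lemma mm_ne {d : ℕ} (p : ℝ) {a x : Fin 3 → ℝ} (ha : ∀ i, 0 < a i) (e : EuclideanSpace ℝ (Fin d)) :
    mm p a x e ≠ 0 := by
  intro h
  have h2 : mm p a x e Set.univ = 0 := by rw [h]; simp
  simp [mm] at h2
  have := rpow_pos_of_pos (ha 0) p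
  have := h2 0
  linarith

lemma heat_eq {d : ℕ} {p : ℝ} (hp : 1 ≤ p) {a x : Fin 3 → ℝ} (ha : ∀ i, 0 < a i)
    (e : EuclideanSpace ℝ (Fin d)) {s : ℝ} (hs : 0 < s) (y : EuclideanSpace ℝ (Fin d)) :
    heatEvolution d (mm p a x e) (s ^ 2) y ^ (1 / p) =
      (s ^ (-(d : ℝ))) ^ (1 / p) * FF p a x e s⁻¹ (s⁻¹ • y) := by
  have h0 : heatEvolution d (mm p a x e) (s ^ 2) y =
      s ^ (-(d : ℝ)) * ∑ i, bb p a x e (s⁻¹ • y) s⁻¹ i ^ p := by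
    unfold heatEvolution mm
    rw [integral_finsetSum_measure]
    · rw [Finset.mul_sum]
      refine Finset.sum_congr rfl fun i _ => ?_
      rw [integral_smul_measure, integral_dirac, ENNReal.toReal_ofReal (rpow_nonneg (ha i).le p)]
      unfold heatKernel bb
      have e1 : (s ^ 2) ^ (-(d : ℝ) / 2) = s ^ (-(d : ℝ)) := by
        rw [← Real.rpow_natCast, ← Real.rpow_mul hs.le]; congr 1; push_cast; ring
      rw [e1, smul_eq_mul, Real.mul_rpow (ha i).le (exp_pos _).le, ← Real.exp_mul]
      have e2 : s⁻¹ • y - (s⁻¹ * x i) • e = s⁻¹ • (y - x i • e) := by module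
      rw [e2, norm_smul, Real.norm_of_nonneg (inv_pos.2 hs).le]
      have e3 : -π * ‖y - x i • e‖ ^ 2 / s ^ 2 = -(π / p) * (s⁻¹ * ‖y - x i • e‖) ^ 2 * p := by
        have : p ≠ 0 := by linarith
        field_simp
      rw [e3]; ring
    · intro i _
      refine Integrable.smul_measure ?_ ENNReal.ofReal_ne_top
      exact integrable_dirac (by simp)
  rw [h0, Real.mul_rpow (by positivity)]
  · rfl
  · exact Finset.sum_nonneg fun i _ => (rpow_pos_of_pos (bb_pos ha _ _ i) p).le

lemma fourier_scale {d : ℕ} (f : EuclideanSpace ℝ (Fin d) → ℂ) (c : ℝ) {s : ℝ} (hs : 0 < s)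
    (ξ : EuclideanSpace ℝ (Fin d)) :
    𝓕 (fun y => (c : ℂ) * f (s⁻¹ • y)) ξ = ((c * s ^ d : ℝ) : ℂ) * 𝓕 f (s • ξ) := by
  rw [Real.fourier_eq, Real.fourier_eq]
  have h := Measure.integral_comp_inv_smul_of_nonneg (volume : Measure (EuclideanSpace ℝ (Fin d)))
    (fun v => 𝐞 (-inner ℝ v (s • ξ)) • f v) hs.le
  rw [finrank_euclideanSpace_fin] at h
  have : ∀ v : EuclideanSpace ℝ (Fin d), inner ℝ (s⁻¹ • v) (s • ξ) = inner ℝ v ξ := by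
    intro v
    rw [inner_smul_left, inner_smul_right]
    simp; field_simp
  simp_rw [this] at h
  rw [Complex.ofReal_mul, mul_assoc, ← Complex.real_smul (x := s ^ d), ← h, ← integral_const_mul]
  congr 1; ext v
  rw [Circle.smul_def, Circle.smul_def, smul_eq_mul, smul_eq_mul]; ring

lemma Q_eq {d : ℕ} {p q : ℝ} (hp : 1 ≤ p) (hq : 2 ≤ q) {a x : Fin 3 → ℝ} (ha : ∀ i, 0 < a i)
    (e : EuclideanSpace ℝ (Fin d)) {s : ℝ} (hs : 0 < s)
    (hi : Integrable (fun y => (FF p a x e s⁻¹ y : ℂ))) :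
    Q d (mm p a x e) p q (s ^ 2) = (∫ ξ, ‖𝓕 (fun y => (FF p a x e s⁻¹ y : ℂ)) ξ‖ ^ q) ^ (1 / q) := by
  unfold Q
  set f : EuclideanSpace ℝ (Fin d) → ℂ := fun y => (FF p a x e s⁻¹ y : ℂ) with hf
  set c : ℝ := (s ^ (-(d : ℝ))) ^ (1 / p) with hc
  have hc0 : 0 < c := by positivity
  have h1 : (𝓕 fun y => ((heatEvolution d (mm p a x e) (s ^ 2) y ^ (1 / p) : ℝ) : ℂ))
      = fun ξ => ((c * s ^ d : ℝ) : ℂ) * 𝓕 f (s • ξ) := by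
    ext ξ
    rw [← fourier_scale f c hs]
    have : (fun y => ((heatEvolution d (mm p a x e) (s ^ 2) y ^ (1 / p) : ℝ) : ℂ))
        = fun y => (c : ℂ) * f (s⁻¹ • y) := by
      ext y
      rw [heat_eq hp ha e hs]; push_cast; rfl
    rw [this]
  rw [h1]
  have hcont : Continuous (fun ξ => ((c * s ^ d : ℝ) : ℂ) * 𝓕 f (s • ξ)) :=
    continuous_const.mul ((cont_fourier hi).comp (by fun_prop))
  rw [toReal_eLpNorm hcont.aestronglyMeasurable,
    lpNorm_eq_integral_norm_rpow_toReal (by simp; linarith) ENNReal.ofReal_ne_top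
      hcont.aestronglyMeasurable, ENNReal.toReal_ofReal (by linarith)]
  have h2 : ∀ ξ, ‖((c * s ^ d : ℝ) : ℂ) * 𝓕 f (s • ξ)‖ ^ q = (c * s ^ d) ^ q * ‖𝓕 f (s • ξ)‖ ^ q := by
    intro ξ
    rw [norm_mul, Complex.norm_real, Real.norm_of_nonneg (by positivity),
      Real.mul_rpow (by positivity) (by positivity)]
  simp_rw [h2]
  rw [integral_const_mul]
  have h3 := Measure.integral_comp_smul_of_nonneg (volume : Measure (EuclideanSpace ℝ (Fin d)))
    (fun ξ => ‖𝓕 f ξ‖ ^ q) s (hR := hs.le)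
  rw [h3, finrank_euclideanSpace_fin, smul_eq_mul]
  set N := ∫ ξ, ‖𝓕 f ξ‖ ^ q with hN
  have hN0 : 0 ≤ N := integral_nonneg fun _ => by positivity
  rw [← mul_assoc, Real.mul_rpow (by positivity) hN0, ← mul_assoc, ← one_div q]
  have hq0 : q ≠ 0 := by linarith
  have hp0 : p ≠ 0 := by linarith
  have : (s ^ 2) ^ ((d : ℝ) / 2 * (1 / q - (1 - 1 / p))) * ((c * s ^ d) ^ q * (s ^ d)⁻¹) ^ (1 / q) = 1 := by
    rw [hc, ← Real.rpow_natCast s 2, ← Real.rpow_natCast s d, ← Real.rpow_mul hs.le,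
      ← Real.rpow_mul hs.le, ← Real.rpow_add hs, ← Real.rpow_mul hs.le, ← Real.rpow_neg hs.le,
      ← Real.rpow_add hs, ← Real.rpow_mul hs.le, ← Real.rpow_add hs]
    have : ((2 : ℕ) : ℝ) * ((d : ℝ) / 2 * (1 / q - (1 - 1 / p))) +
      ((-(d : ℝ) * (1 / p) + d) * q + -d) * (1 / q) = 0 := by
      push_cast; field_simp; ring
    rw [this, Real.rpow_zero]
  rw [this, one_mul]


lemma mono_of_step {N : ℝ → ℝ} {Λ : ℝ}
    (h : ∀ l₁ l₂, Λ ≤ l₁ → l₁ < l₂ → l₂ ≤ l₁ + 1 → N l₁ < N l₂) :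
    ∀ l₁ l₂, Λ ≤ l₁ → l₁ < l₂ → N l₁ < N l₂ := by
  have key : ∀ n : ℕ, ∀ l₁ l₂, Λ ≤ l₁ → l₁ < l₂ → l₂ ≤ l₁ + n → N l₁ < N l₂ := by
    intro n
    induction n with
    | zero => intro l₁ l₂ _ h2 h3; simp at h3; linarith
    | succ n ih =>
      intro l₁ l₂ h1 h2 h3
      push_cast at h3
      rcases le_or_gt l₂ (l₁ + 1) with h4 | h4
      · exact h _ _ h1 h2 h4
      · exact (h l₁ (l₁ + 1) h1 (by linarith) le_rfl).trans
          (ih (l₁ + 1) l₂ (by linarith) h4 (by linarith))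
  intro l₁ l₂ h1 h2
  obtain ⟨n, hn⟩ := exists_nat_ge (l₂ - l₁)
  exact key n l₁ l₂ h1 h2 (by linarith)

lemma mvt {f : ℝ → ℝ} {l₁ l₂ M : ℝ} (h12 : l₁ ≤ l₂)
    (h : ∀ l ∈ Set.Icc l₁ l₂, ∃ g', HasDerivAt f g' l ∧ |g'| ≤ M) :
    |f l₂ - f l₁| ≤ M * (l₂ - l₁) := by
  have := Convex.norm_image_sub_le_of_norm_deriv_le (f := f) (C := M) (s := Set.Icc l₁ l₂)
    (fun l hl => by obtain ⟨g, hg, -⟩ := h l hl; exact hg.differentiableAt)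
    (fun l hl => by obtain ⟨g, hg, hb⟩ := h l hl; rw [hg.deriv]; exact hb)
    (convex_Icc _ _) (Set.left_mem_Icc.2 h12) (Set.right_mem_Icc.2 h12)
  rwa [Real.norm_eq_abs, Real.norm_eq_abs, abs_of_nonneg (sub_nonneg.2 h12)] at this

lemma err_step {d : ℕ} {p q : ℝ} (hp : 1 ≤ p) (hq : 2 ≤ q) {a x : Fin 3 → ℝ}
    {e : EuclideanSpace ℝ (Fin d)} (he : ‖e‖ = 1) {X : ℝ}
    (ha : ∀ i, 0 < a i) (ha1 : ∀ i, a i ≤ 1) (hx : ∀ i, |x i| ≤ X)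
    (hgap : ∀ i j, i ≠ j → 4 ≤ |x i - x j|) : 
    ∃ K > 0, ∀ l₁ l₂, 1 ≤ l₁ → l₁ < l₂ → l₂ ≤ l₁ + 1 →
      Integrable (fun y => (FF p a x e l₁ y : ℂ)) ∧
      |((∫ ξ, ‖𝓕 (fun y => (FF p a x e l₂ y : ℂ)) ξ‖ ^ q) - ∫ ξ, ‖𝓕 (fun y => (FF p a x e l₁ y : ℂ)) ξ‖ ^ q)
        - ((∫ ξ, ‖𝓕 (fun y => (GG p a x e l₂ y : ℂ)) ξ‖ ^ q) - ∫ ξ, ‖𝓕 (fun y => (GG p a x e l₁ y : ℂ)) ξ‖ ^ q)|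
        ≤ K * rexp (-(3 * (π / p)) * l₁ ^ 2) * (l₂ - l₁) := by
  have hX : 0 ≤ X := (abs_nonneg _).trans (hx 0)
  have hp0 : 0 < p := by linarith
  have hq0 : 0 < q := by linarith
  set ω := π / (p * q) with hω
  set η := ω / (4 * (4 * X ^ 2 + 1)) with hη
  have hω0 : 0 < ω := by positivity
  have hη0 : 0 < η := by positivity
  have hηω : 4 * ((4 * X ^ 2 + 1) * η) = ω := by rw [hη]; field_simp
  have hqω : q * ω = π / p := by rw [hω]; field_simp
  have hηp : 4 * η * p ≤ π := by
    have h1 : 4 * η ≤ ω := by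
      rw [← hηω]; nlinarith [mul_nonneg (sq_nonneg X) hη0.le]
    have h2 : p * ω ≤ π := by
      have : p * ω = π / q := by rw [hω]; field_simp
      rw [this]; exact div_le_self pi_pos.le (by linarith)
    nlinarith
  obtain ⟨C, hC, hpt⟩ := pointwise (d := d) hp hη0 hηp he ha ha1 hx hgap
  obtain ⟨K, hK, herr⟩ := err_bound (d := d) hη0 hq
  obtain ⟨c, hc, hg⟩ := gdom (d := d) hη0
  refine ⟨K * C ^ (q - 2) * C * C, by positivity, ?_⟩
  intro l₁ l₂ h1 h2 h3
  have hm1 : ∀ l ∈ Set.Icc l₁ l₂, C * rexp ((4 * X ^ 2 + 1) * η * l ^ 2) ≤ C * rexp (ω * l₁ ^ 2) := by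
    intro l hl
    have : l ^ 2 ≤ (2 * l₁) ^ 2 := by
      refine pow_le_pow_left₀ ?_ ?_ 2 <;> linarith [hl.1, hl.2]
    have : (4 * X ^ 2 + 1) * η * l ^ 2 ≤ ω * l₁ ^ 2 := by
      rw [← hηω]
      have h0 : 0 ≤ (4 * X ^ 2 + 1) * η := by positivity
      nlinarith [mul_le_mul_of_nonneg_left this h0]
    gcongr
  have hm2 : ∀ l ∈ Set.Icc l₁ l₂, C * rexp (((4 * X ^ 2 + 1) * η - 4 * (π / p)) * l ^ 2) ≤
      C * rexp ((ω - 4 * (π / p)) * l₁ ^ 2) := by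
    intro l hl
    have i1 : l ^ 2 ≤ (2 * l₁) ^ 2 := by
      refine pow_le_pow_left₀ ?_ ?_ 2 <;> linarith [hl.1, hl.2]
    have i2 : l₁ ^ 2 ≤ l ^ 2 := by
      refine pow_le_pow_left₀ ?_ ?_ 2 <;> linarith [hl.1, hl.2]
    have i3 : (4 * X ^ 2 + 1) * η * l ^ 2 ≤ ω * l₁ ^ 2 := by
      rw [← hηω]
      have h0 : 0 ≤ (4 * X ^ 2 + 1) * η := by positivity
      nlinarith [mul_le_mul_of_nonneg_left i1 h0]
    have i4 : (π / p) * l₁ ^ 2 ≤ (π / p) * l ^ 2 := by gcongr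
    have : ((4 * X ^ 2 + 1) * η - 4 * (π / p)) * l ^ 2 ≤ (ω - 4 * (π / p)) * l₁ ^ 2 := by
      rw [sub_mul, sub_mul, mul_assoc 4, mul_assoc 4]
      linarith
    gcongr
  set A := C * rexp (ω * l₁ ^ 2) with hA
  set B := C * rexp ((ω - 4 * (π / p)) * l₁ ^ 2) with hB
  have m1 : l₁ ∈ Set.Icc l₁ l₂ := Set.left_mem_Icc.2 h2.le
  have m2 : l₂ ∈ Set.Icc l₁ l₂ := Set.right_mem_Icc.2 h2.le
  have pos : ∀ l ∈ Set.Icc l₁ l₂, 0 ≤ l := fun l hl => by linarith [hl.1]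
  have bG : ∀ l ∈ Set.Icc l₁ l₂, ∀ y, ‖(GG p a x e l y : ℂ)‖ ≤ A * rexp (-η * ‖y‖ ^ 2) := by
    intro l hl y
    obtain ⟨f0, g0, fg, gb, -⟩ := hpt l y (pos l hl)
    rw [Complex.norm_real, Real.norm_of_nonneg g0]
    exact gb.trans (mul_le_mul_of_nonneg_right (hm1 l hl) (exp_pos _).le)
  have bF : ∀ l ∈ Set.Icc l₁ l₂, ∀ y, ‖(FF p a x e l y : ℂ)‖ ≤ A * rexp (-η * ‖y‖ ^ 2) := by
    intro l hl y
    obtain ⟨f0, g0, fg, gb, -⟩ := hpt l y (pos l hl)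
    rw [Complex.norm_real, Real.norm_of_nonneg f0]
    exact fg.trans (gb.trans (mul_le_mul_of_nonneg_right (hm1 l hl) (exp_pos _).le))
  have bH : ∀ l ∈ Set.Icc l₁ l₂, ∀ y, ‖(FF p a x e l y : ℂ) - (GG p a x e l y : ℂ)‖
      ≤ B * rexp (-η * ‖y‖ ^ 2) := by
    intro l hl y
    obtain ⟨-, -, -, -, hb, -⟩ := hpt l y (pos l hl)
    rw [← Complex.ofReal_sub, Complex.norm_real, Real.norm_eq_abs]
    exact hb.trans (mul_le_mul_of_nonneg_right (hm2 l hl) (exp_pos _).le)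
  have bdG : ∀ y, ‖(GG p a x e l₂ y : ℂ) - (GG p a x e l₁ y : ℂ)‖
      ≤ (A * (l₂ - l₁)) * rexp (-η * ‖y‖ ^ 2) := by
    intro y
    rw [← Complex.ofReal_sub, Complex.norm_real, Real.norm_eq_abs, mul_right_comm]
    refine mvt (f := fun l => GG p a x e l y) h2.le fun l hl => ?_
    obtain ⟨-, -, -, -, -, ⟨g, hg, hb⟩, -⟩ := hpt l y (pos l hl)
    exact ⟨g, hg, hb.trans (mul_le_mul_of_nonneg_right (hm1 l hl) (exp_pos _).le)⟩
  have bdH : ∀ y, ‖((FF p a x e l₂ y : ℂ) - (GG p a x e l₂ y : ℂ)) -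
      ((FF p a x e l₁ y : ℂ) - (GG p a x e l₁ y : ℂ))‖
      ≤ (B * (l₂ - l₁)) * rexp (-η * ‖y‖ ^ 2) := by
    intro y
    rw [← Complex.ofReal_sub, ← Complex.ofReal_sub, ← Complex.ofReal_sub, Complex.norm_real,
      Real.norm_eq_abs, mul_right_comm]
    refine mvt (f := fun l => FF p a x e l y - GG p a x e l y) h2.le fun l hl => ?_
    obtain ⟨-, -, -, -, -, -, ⟨g, hg, hb⟩⟩ := hpt l y (pos l hl)
    exact ⟨g, hg, hb.trans (mul_le_mul_of_nonneg_right (hm2 l hl) (exp_pos _).le)⟩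
  have cF : ∀ l, Continuous (fun y => (FF p a x e l y : ℂ)) := fun l =>
    Complex.continuous_ofReal.comp (cont_FF hp ha l)
  have cG : ∀ l, Continuous (fun y => (GG p a x e l y : ℂ)) := fun l =>
    Complex.continuous_ofReal.comp (cont_GG l)
  have hA0 : 0 ≤ A := by positivity
  have hB0 : 0 ≤ B := by positivity
  refine ⟨(hg _ A hA0 (cF l₁) (bF l₁ m1)).1, ?_⟩
  refine (herr _ _ _ _ A B (l₂ - l₁) hA0 hB0 (by linarith) (cF l₁) (cF l₂) (cG l₁) (cG l₂)
    (bF _ m1) (bF _ m2) (bG _ m1) (bG _ m2) (bH _ m1) (bH _ m2) bdG bdH).2.trans (le_of_eq ?_)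
  have e1 : A ^ (q - 2) * A * B = C ^ (q - 2) * C * C * rexp (-(3 * (π / p)) * l₁ ^ 2) := by
    rw [hA, hB, Real.mul_rpow hC.le (exp_pos _).le, ← Real.exp_mul]
    have : rexp (-(3 * (π / p)) * l₁ ^ 2) = rexp (ω * l₁ ^ 2 * (q - 2)) * rexp (ω * l₁ ^ 2) *
        rexp ((ω - 4 * (π / p)) * l₁ ^ 2) := by
      rw [← Real.exp_add, ← Real.exp_add, ← hqω]; congr 1; ring
    rw [this]; ring
  calc K * A ^ (q - 2) * A * B * (l₂ - l₁) = K * (A ^ (q - 2) * A * B) * (l₂ - l₁) := by ring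
    _ = _ := by rw [e1]; ring

lemma exp_diff {ω l₁ l₂ : ℝ} (hω : 0 < ω) (h1 : 1 ≤ l₁) (h2 : l₁ < l₂) (h3 : l₂ ≤ l₁ + 1) :
    rexp (-(4 * ω) * l₁ ^ 2) * ω * (l₂ - l₁) ≤ rexp (-ω * l₁ ^ 2) - rexp (-ω * l₂ ^ 2) := by
  have e1 : rexp (-ω * l₁ ^ 2) = rexp (-ω * l₂ ^ 2) * rexp (ω * (l₂ ^ 2 - l₁ ^ 2)) := by
    rw [← Real.exp_add]; congr 1; ring
  have e2 := Real.add_one_le_exp (ω * (l₂ ^ 2 - l₁ ^ 2))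
  have e3 : rexp (-(4 * ω) * l₁ ^ 2) ≤ rexp (-ω * l₂ ^ 2) := by
    rw [Real.exp_le_exp]
    have h4 : l₂ ^ 2 ≤ (2 * l₁) ^ 2 := by
      refine pow_le_pow_left₀ ?_ ?_ 2 <;> linarith
    have h5 := mul_le_mul_of_nonneg_left h4 hω.le
    nlinarith
  have e4 : ω * (l₂ - l₁) ≤ ω * (l₂ ^ 2 - l₁ ^ 2) := by
    have : l₂ - l₁ ≤ l₂ ^ 2 - l₁ ^ 2 := by nlinarith
    exact mul_le_mul_of_nonneg_left this hω.le
  have e5 : 0 < rexp (-ω * l₂ ^ 2) := exp_pos _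
  have e6 : 0 ≤ ω * (l₂ - l₁) := mul_nonneg hω.le (by linarith)
  calc rexp (-(4 * ω) * l₁ ^ 2) * ω * (l₂ - l₁) = rexp (-(4 * ω) * l₁ ^ 2) * (ω * (l₂ - l₁)) := by ring
    _ ≤ rexp (-ω * l₂ ^ 2) * (rexp (ω * (l₂ ^ 2 - l₁ ^ 2)) - 1) := by
      apply mul_le_mul e3 (by linarith) e6 e5.le
    _ = _ := by rw [e1]; ring

lemma exp_win {β γ K M : ℝ} (hM : 0 < M) (hβγ : β < γ) : ∃ Λ, ∀ l, 1 ≤ l → Λ ≤ l →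
    K * rexp (-γ * l ^ 2) < M * rexp (-β * l ^ 2) := by
  refine ⟨K / (M * (γ - β)), fun l h1 hl => ?_⟩
  have hg : 0 < γ - β := by linarith
  have e1 : rexp (-β * l ^ 2) = rexp (-γ * l ^ 2) * rexp ((γ - β) * l ^ 2) := by
    rw [← Real.exp_add]; congr 1; ring
  have e2 := Real.add_one_le_exp ((γ - β) * l ^ 2)
  rw [div_le_iff₀ (by positivity)] at hl
  have e3 : K < M * rexp ((γ - β) * l ^ 2) := by
    have : l * (M * (γ - β)) ≤ M * ((γ - β) * l ^ 2) := by
      have h0 : 0 < M * (γ - β) := by positivity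
      nlinarith [mul_nonneg h0.le (mul_nonneg (by linarith : (0 : ℝ) ≤ l) (by linarith : (0 : ℝ) ≤ l - 1))]
    nlinarith
  rw [e1]
  have := exp_pos (-γ * l ^ 2)
  nlinarith

lemma main_mono {d : ℕ} {p q : ℝ} (hp : 1 ≤ p) (hq : 2 < q) (hqodd : ∀ k : ℕ, q ≠ 2 * k)
    (e : EuclideanSpace ℝ (Fin d)) (he : ‖e‖ = 1) :
    ∃ a x : Fin 3 → ℝ, (∀ i, 0 < a i) ∧ ∃ Λ ≥ 1, 
      (∀ l, 1 ≤ l → Integrable (fun y => (FF p a x e l y : ℂ))) ∧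
      ∀ l₁ l₂, Λ ≤ l₁ → l₁ < l₂ →
        ∫ ξ, ‖𝓕 (fun y => (FF p a x e l₁ y : ℂ)) ξ‖ ^ q < ∫ ξ, ‖𝓕 (fun y => (FF p a x e l₂ y : ℂ)) ξ‖ ^ q := by
  have hp0 : 0 < p := by linarith
  have hq0 : 0 < q := by linarith
  have hk1 : ∃ k : ℕ, 2 * (k : ℝ) < q ∧ q < 2 * k + 2 := by
    refine ⟨⌊q / 2⌋₊, ?_, ?_⟩
    · have := Nat.floor_le (a := q / 2) (by positivity)
      exact lt_of_le_of_ne (by linarith) (hqodd _).symm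
    · have := Nat.lt_floor_add_one (q / 2)
      linarith
  obtain ⟨k, hk, hk'⟩ := hk1
  obtain ⟨r, s, hr, hs, hrs, hneg⟩ := exists_neg hq k hk hk'
  have ha : ∀ i, 0 < (![1, r, s] : Fin 3 → ℝ) i := by
    intro i; fin_cases i <;> simp [hr, hs]
  have ha1 : ∀ i, (![1, r, s] : Fin 3 → ℝ) i ≤ 1 := by
    intro i; fin_cases i <;> simp <;> linarith
  have hk0 : (0 : ℝ) ≤ k := Nat.cast_nonneg k
  have hx : ∀ i, |(![0, 4, (4 * k + 7 : ℕ)] : Fin 3 → ℝ) i| ≤ 4 * k + 7 := by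
    intro i; fin_cases i <;> simp [abs_le] <;> (try constructor) <;> linarith
  have hgap : ∀ i j, i ≠ j → 4 ≤ |(![0, 4, (4 * k + 7 : ℕ)] : Fin 3 → ℝ) i -
      (![0, 4, (4 * k + 7 : ℕ)] : Fin 3 → ℝ) j| := by
    intro i j hij
    have hk1' : (1 : ℝ) ≤ k := by
      have h0 : (0 : ℝ) < k := by linarith
      have h1 : 0 < k := by exact_mod_cast h0
      exact_mod_cast h1
    have g1 : (4 : ℝ) ≤ |(0 : ℝ) - 4| := by norm_num
    have g2 : (4 : ℝ) ≤ |(0 : ℝ) - (4 * k + 7 : ℕ)| := by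
      rw [le_abs]; right; push_cast; linarith
    have g3 : (4 : ℝ) ≤ |(4 : ℝ) - (4 * k + 7 : ℕ)| := by
      rw [le_abs]; right; push_cast; linarith
    have g1' := g1
    have g2' := g2
    have g3' := g3
    rw [abs_sub_comm] at g1' g2' g3'
    fin_cases i <;> fin_cases j <;> first | exact absurd rfl hij | exact g1 | exact g2 | exact g3 | exact g1' | exact g2' | exact g3'
  obtain ⟨K, hK, herr⟩ := err_step (d := d) hp hq.le he ha ha1 hx hgap
  obtain ⟨c0, hc0, L, hL, hmain⟩ := main_lower_PP (d := d) (τ := π * p * q) (by positivity) e he hr hs hrs hneg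
  set ω := π / (p * q) with hω
  have hω0 : 0 < ω := by positivity
  have hτ : π ^ 2 / (π * p * q) = ω := by rw [hω]; have := pi_pos.ne'; field_simp
  rw [hτ] at hmain
  have hqω : q * ω = π / p := by rw [hω]; field_simp
  set P := (p ^ ((d : ℝ) / 2)) ^ q with hP
  have hP0 : 0 < P := by positivity
  obtain ⟨Λ, hΛ⟩ := exp_win (β := 4 * ω) (γ := 3 * (π / p)) (K := K) (M := P * c0 * ω)
    (by positivity) (by rw [← hqω]; nlinarith)
  refine ⟨_, _, ha, max 1 (max L Λ), le_max_left _ _, fun l hl => (herr l (l + 1) hl (by linarith) le_rfl).1, ?_⟩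
  apply mono_of_step
  intro l₁ l₂ h1 h2 h3
  simp only [max_le_iff] at h1
  obtain ⟨h11, h1L, h1Λ⟩ := h1
  have k1 := (herr l₁ l₂ h11 h2 h3).2
  have k2 := hmain l₁ l₂ h1L h2
  have k3 := exp_diff hω0 h11 h2 h3
  have k4 := hΛ l₁ h11 h1Λ
  have k5 : ∀ l, ∫ ξ, ‖𝓕 (fun y => (GG p ![1, r, s] ![0, 4, (4 * k + 7 : ℕ)] e l y : ℂ)) ξ‖ ^ q
      = P * ∫ ξ, (rexp (-(π * p * q) * ‖ξ‖ ^ 2) * ‖PP k r s (l * inner ℝ e ξ)‖ ^ q) := by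
    intro l
    rw [← integral_const_mul]
    congr 1; ext ξ; exact fourier_GG hp0 k r s l ξ
  rw [k5, k5, ← mul_sub] at k1
  have k6 := mul_le_mul_of_nonneg_left (le_trans (mul_le_mul_of_nonneg_left k3 hc0.le) k2) hP0.le
  have k7 := (abs_le.1 k1).1
  have k8 : K * rexp (-(3 * (π / p)) * l₁ ^ 2) * (l₂ - l₁) < P * c0 * ω * rexp (-(4 * ω) * l₁ ^ 2) * (l₂ - l₁) :=
    mul_lt_mul_of_pos_right k4 (by linarith)
  have k9 : P * (c0 * (rexp (-(4 * ω) * l₁ ^ 2) * ω * (l₂ - l₁))) =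
    P * c0 * ω * rexp (-(4 * ω) * l₁ ^ 2) * (l₂ - l₁) := by ring
  rw [k9] at k6
  linarith

theorem statement0 (d : ℕ) (hd : 0 < d) (p q : ℝ) (hp : 1 ≤ p) (hq : 2 ≤ q)
    (hqp : 1 - 1 / p ≤ 1 / q) (hqodd : ∀ k : ℕ, q ≠ 2 * k) :
    ∃ μ : Measure (EuclideanSpace ℝ (Fin d)), μ ≠ 0 ∧ IsFiniteMeasure μ ∧
      ∃ t₀ > 0, StrictAntiOn (Q d μ p q) (Set.Ioo 0 t₀) := by
  have hq2 : 2 < q := lt_of_le_of_ne hq (by have := hqodd 1; intro h; apply this; simp [← h])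
  set e : EuclideanSpace ℝ (Fin d) := EuclideanSpace.single ⟨0, hd⟩ 1 with he
  have he1 : ‖e‖ = 1 := by simp [he]
  obtain ⟨a, x, ha, Λ, hΛ, hint, hmono⟩ := main_mono hp hq2 hqodd e he1
  have hΛ0 : 0 < Λ := by linarith
  refine ⟨mm p a x e, mm_ne p ha e, mm_finite p a x e, (Λ⁻¹) ^ 2, by positivity, ?_⟩
  intro t₁ ht₁ t₂ ht₂ h12
  have key : ∀ t, t ∈ Set.Ioo 0 ((Λ⁻¹) ^ 2) → 0 < √t ∧ Λ < (√t)⁻¹ := by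
    intro t ht
    have h1 : 0 < √t := Real.sqrt_pos.2 ht.1
    refine ⟨h1, ?_⟩
    rw [lt_inv_comm₀ hΛ0 h1]
    exact (Real.sqrt_lt' (by positivity)).2 ht.2
  obtain ⟨p1, l1⟩ := key t₁ ht₁
  obtain ⟨p2, l2⟩ := key t₂ ht₂
  have e1 := Q_eq hp hq ha e p1 (hint _ (by linarith))
  have e2 := Q_eq hp hq ha e p2 (hint _ (by linarith))
  rw [Real.sq_sqrt ht₁.1.le] at e1
  rw [Real.sq_sqrt ht₂.1.le] at e2
  rw [e1, e2]
  apply Real.rpow_lt_rpow (integral_nonneg fun _ => by positivity)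
  · apply hmono _ _ l2.le
    rw [inv_lt_inv₀ p2 p1]
    exact Real.sqrt_lt_sqrt ht₁.1.le h12
  · positivity
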